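/- Fine grained analysis of high dimensional random walks. Let (X, w) be a weighted pure d-dimensional simplicial complex, and for every −1 ≤ j ≤ d−2 let γ_j = max over σ ∈ X(j) of the second largest eigenvalue of the non-lazy random walk on the 1-skeleton of the link X_σ (with γ_{−1} the second largest eigenvalue for X itself). Let 0 ≤ k ≤ d−1 and, for 0 ≤ i ≤ k, let f_i ∈ C^k(X; ℝ) be a proper i-level cochain with respect to localization; set f = Σ_{i=0}^k f_i. Then ⟨M_k^+ f, f⟩ ≤ Σ_{i=0}^k (1 − (1/(k−i+1)) Π_{j=i−1}^{k−1} (1 − γ_j)) ‖f_i‖². -/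

import Mathlib

/-!
Weighted pure simplicial complexes, links, cochains, signless differentials
and high dimensional random walk operators.

Conventions: faces are `Finset`s of vertices. A cochain "of dimension `k`"
(an element of `C^k(X;ℝ)`) is represented by a function `Finset V → ℝ`
evaluated on faces of **cardinality** `c = k + 1`; all operators are indexed
by cardinality.
-/

open Finset

namespace HDRW

noncomputable section

variable {V : Type*} [DecidableEq V] [Fintype V]

/-- A weighted family of faces (the data of a weighted complex or of a link). -/
structure WFam (V : Type*) [DecidableEq V] [Fintype V] where
  faces : Finset (Finset V)
  w : Finset V → ℝ

namespace WFam

/-- The faces of cardinality `c` (i.e. of dimension `c - 1`). -/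
def dimFaces (Y : WFam V) (c : ℕ) : Finset (Finset V) :=
  Y.faces.filter fun σ => σ.card = c

/-- The link of a face `τ`, as a weighted family; the weights are
`w_τ(s) = w (s ∪ τ) / (C(|s| + |τ|, |τ|) * w τ)`. -/
def link (Y : WFam V) (τ : Finset V) : WFam V where
  faces := Finset.univ.powerset.filter fun s => Disjoint s τ ∧ s ∪ τ ∈ Y.faces
  w := fun s => Y.w (s ∪ τ) / (((s.card + τ.card).choose τ.card : ℝ) * Y.w τ)

/-- The inner product of two `c`-cochains: `⟨f, g⟩ = Σ_{σ} w σ * f σ * g σ`. -/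
def inner (Y : WFam V) (c : ℕ) (f g : Finset V → ℝ) : ℝ :=
  ∑ σ ∈ Y.dimFaces c, Y.w σ * (f σ * g σ)

/-- The squared norm `‖f‖² = ⟨f, f⟩` of a `c`-cochain. -/
def norm2 (Y : WFam V) (c : ℕ) (f : Finset V → ℝ) : ℝ := Y.inner c f f

end WFam

/-- The signless differential `d` from cochains on faces of cardinality `c`
(dimension `c-1`) to cochains on faces of cardinality `c+1`:
`(d f)(σ) = (1/(c+1)) Σ_{τ ⊆ σ, |τ| = c} f τ`. -/
def sDiff (c : ℕ) (f : Finset V → ℝ) : Finset V → ℝ :=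
  fun σ => ((c : ℝ) + 1)⁻¹ * ∑ τ ∈ σ.powerset.filter (fun τ => τ.card = c), f τ

/-- Iterated signless differential `C_a → C_{a+n}` (in cardinality indexing),
i.e. `d_{a+n-2} ⋯ d_{a-1}` in dimension indexing. -/
def sDiffIter (a : ℕ) : ℕ → (Finset V → ℝ) → (Finset V → ℝ)
  | 0, f => f
  | n + 1, f => sDiff (a + n) (sDiffIter a n f)

namespace WFam

/-- The adjoint `d^*` of the signless differential, from cochains on faces of
cardinality `c+1` to cochains on faces of cardinality `c`; it is given by the
explicit formula `(d^* f)(τ) = Σ_{σ ∈ X(c), τ ⊆ σ} w_τ(σ ∖ τ) * f σ` (a sum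
over the cardinality-`(c+1)` faces containing `τ`). -/
def sAdj (Y : WFam V) (c : ℕ) (f : Finset V → ℝ) : Finset V → ℝ :=
  fun τ => ∑ σ ∈ (Y.dimFaces (c + 1)).filter (fun σ => τ ⊆ σ),
    (Y.link τ).w (σ \ τ) * f σ

/-- Iterated adjoint of the signless differential, `C_{a+n} → C_a`
(in cardinality indexing), i.e. `d_{a-1}^* ⋯ d_{a+n-2}^*`. -/
def sAdjIter (Y : WFam V) : ℕ → ℕ → (Finset V → ℝ) → (Finset V → ℝ)
  | _, 0, f => f
  | a, n + 1, f => Y.sAdj a (sAdjIter Y (a + 1) n f)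

/-- The non-lazy up-down random walk operator `M⁺` on cochains of cardinality
`c` (dimension `k = c-1`): `(M⁺ f)(σ) = (1/(k+1)) Σ_{τ, σ ∪ τ ∈ X(k+1)} w_σ(τ∖σ) f τ`. -/
def nonLazy (Y : WFam V) (c : ℕ) (f : Finset V → ℝ) : Finset V → ℝ :=
  fun σ => (c : ℝ)⁻¹ *
    ∑ τ ∈ (Y.dimFaces c).filter (fun τ => σ ∪ τ ∈ Y.dimFaces (c + 1)),
      (Y.link σ).w (τ \ σ) * f τ

/-- The (lazy) up-down random walk operator `U` on cochains of cardinality `c`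
(dimension `k = c-1`):
`(U f)(σ) = (1/(k+2)) f σ + (1/(k+2)) Σ_{τ, σ ∪ τ ∈ X(k+1)} w_σ(τ∖σ) f τ`. -/
def upDown (Y : WFam V) (c : ℕ) (f : Finset V → ℝ) : Finset V → ℝ :=
  fun σ => ((c : ℝ) + 1)⁻¹ * f σ + ((c : ℝ) + 1)⁻¹ *
    ∑ τ ∈ (Y.dimFaces c).filter (fun τ => σ ∪ τ ∈ Y.dimFaces (c + 1)),
      (Y.link σ).w (τ \ σ) * f τ

/-- The down-up random walk operator `D` on cochains of cardinality `c`
(dimension `k = c-1`). -/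
def downUp (Y : WFam V) (c : ℕ) (f : Finset V → ℝ) : Finset V → ℝ :=
  fun σ => (c : ℝ)⁻¹ *
      (∑ τ' ∈ σ.powerset.filter (fun τ' => τ'.card = c - 1), (Y.link τ').w (σ \ τ')) * f σ
    + (c : ℝ)⁻¹ *
      ∑ τ ∈ (Y.dimFaces c).filter (fun τ => τ ≠ σ ∧ σ ∩ τ ∈ Y.dimFaces (c - 1)),
        (Y.link (σ ∩ τ)).w (τ \ σ) * f τ

/-- The `i`-down-up operator `D^i = d ⋯ d d^* ⋯ d^*` (going down `i+1` steps and
back up) on cochains of cardinality `c` (dimension `k = c-1`); in dimension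
indexing this is `D_k^i = d_{k-1} ⋯ d_{k-i-1} d_{k-i-1}^* ⋯ d_{k-1}^*`. -/
def downUpIter (Y : WFam V) (c i : ℕ) (f : Finset V → ℝ) : Finset V → ℝ :=
  sDiffIter (c - (i + 1)) (i + 1) (Y.sAdjIter (c - (i + 1)) (i + 1) f)

/-- `Y` (through its 1-skeleton) is a `γ`-(one sided) spectral expander:
every function on the vertices orthogonal to the constants has Rayleigh
quotient of the non-lazy random walk at most `γ` (Rayleigh characterization of
"the second largest eigenvalue of `M₀⁺` is at most `γ`"). -/
def isExpander (Y : WFam V) (γ : ℝ) : Prop :=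
  ∀ f : Finset V → ℝ, Y.inner 1 f (fun _ => 1) = 0 →
    Y.inner 1 (Y.nonLazy 1 f) f ≤ γ * Y.norm2 1 f

/-- `Y` (through its 1-skeleton) is connected: the eigenvalue `1` of the
non-lazy random walk `M₀⁺` has multiplicity one, i.e. every nonzero function on
the vertices orthogonal to the constants has Rayleigh quotient strictly
less than `1`. -/
def isConnected (Y : WFam V) : Prop :=
  ∀ f : Finset V → ℝ, Y.inner 1 f (fun _ => 1) = 0 → Y.norm2 1 f ≠ 0 →
    Y.inner 1 (Y.nonLazy 1 f) f < Y.norm2 1 f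

/-- `f` is an `i`-level cochain of cardinality `c` (dimension `k = c-1`) with
respect to localization: for every face `σ` of cardinality `i` (i.e. of
dimension `i-1`), the localization `f_σ` is orthogonal to the constants in the
link `X_σ`. -/
def isLevel (Y : WFam V) (i c : ℕ) (f : Finset V → ℝ) : Prop :=
  ∀ σ ∈ Y.dimFaces i,
    (Y.link σ).inner (c - i) (fun s => f (σ ∪ s)) (fun _ => 1) = 0

/-- `f` is a proper `i`-level cochain of cardinality `c`: it is an `i`-level
cochain which is in addition orthogonal to every `(i+1)`-level cochain. -/
def isProperLevel (Y : WFam V) (i c : ℕ) (f : Finset V → ℝ) : Prop :=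
  Y.isLevel i c f ∧ ∀ g : Finset V → ℝ, Y.isLevel (i + 1) c g → Y.inner c f g = 0

end WFam

/-- The coboundary operator on oriented cochains (represented by their values
on the increasing ordering of each face, with respect to a linear order on the
vertices): `(δ f)(σ) = Σ_{j} (-1)^j f(σ ∖ {j-th smallest element of σ})`. -/
def coboundary {V : Type*} [LinearOrder V] [Fintype V] (f : Finset V → ℝ) :
    Finset V → ℝ :=
  fun σ => ∑ v ∈ σ, (-1 : ℝ) ^ (σ.filter (fun u => u < v)).card * f (σ.erase v)

/-- A weighted pure `d`-dimensional simplicial complex: a downward closed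
family of faces, each contained in a face of cardinality `d+1`
(dimension `d`), together with a weight function `w : X → (0, 1]` summing to
`1` on the top faces and satisfying the averaging recurrence on lower faces. -/
structure WSC (V : Type*) [DecidableEq V] [Fintype V] (d : ℕ) extends WFam V where
  empty_mem : ∅ ∈ faces
  down_closed : ∀ ⦃σ⦄, σ ∈ faces → ∀ ⦃τ⦄, τ ⊆ σ → τ ∈ faces
  isPure : ∀ σ ∈ faces, ∃ σ' ∈ faces, σ ⊆ σ' ∧ σ'.card = d + 1
  w_pos : ∀ σ ∈ faces, 0 < w σ
  w_le_one : ∀ σ ∈ faces, w σ ≤ 1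
  w_sum_top : ∑ σ ∈ faces.filter (fun σ => σ.card = d + 1), w σ = 1
  w_down : ∀ τ ∈ faces, τ.card ≤ d →
    w τ = (((d + 1).choose τ.card : ℝ))⁻¹ *
      ∑ σ ∈ faces.filter (fun σ => σ.card = d + 1 ∧ τ ⊆ σ), w σ


variable {d : ℕ}

def bb (γ : ℕ → ℝ) (k i : ℕ) : ℝ := (((k - i : ℕ) : ℝ) + 1)⁻¹ * ∏ a ∈ Finset.Ico i k, (1 - γ a)

theorem bb_nonneg (γ : ℕ → ℝ) (k i : ℕ) (hγ : ∀ a < k, γ a ≤ 1) : 0 ≤ bb γ k i := by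
  unfold bb
  apply mul_nonneg (by positivity)
  apply Finset.prod_nonneg
  intro a ha
  have := hγ a (Finset.mem_Ico.1 ha).2
  linarith

theorem bb_self (γ : ℕ → ℝ) (k : ℕ) : bb γ k k = 1 := by simp [bb]

theorem bb_step (γ : ℕ → ℝ) (k i : ℕ) (hi : i < k) :
    ((k - i : ℕ) + 1 : ℝ) * bb γ k i = ((k - i : ℕ) : ℝ) * (1 - γ i) * bb γ k (i + 1) := by
  unfold bb
  rw [Finset.prod_eq_prod_Ico_succ_bot hi]
  obtain ⟨m, rfl⟩ : ∃ m, k = i + 1 + m := ⟨k - (i+1), by omega⟩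
  have h1 : i + 1 + m - i = m + 1 := by omega
  have h2 : i + 1 + m - (i + 1) = m := by omega
  rw [h1, h2]
  push_cast
  field_simp

theorem bb_fact (γ : ℕ → ℝ) (d k i : ℕ) (hi : i < k) (hkd : k < d)
    (hlow : -1 ≤ ((d : ℝ) - i) * γ i) :
    ((k - i : ℕ) : ℝ) * (1 - γ i) < ((k - i : ℕ) : ℝ) + 1 := by
  rw [Nat.cast_sub hi.le]
  have h1 : (i : ℝ) < k := by exact_mod_cast hi
  have h2 : (k : ℝ) < d := by exact_mod_cast hkd
  by_cases h : 0 ≤ γ i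
  · nlinarith
  · push Not at h
    nlinarith

theorem bb_le_one (γ : ℕ → ℝ) (d k : ℕ) (hkd : k < d) (hγ : ∀ a < k, γ a ≤ 1)
    (hlow : ∀ a < k, -1 ≤ ((d : ℝ) - a) * γ a) (i : ℕ) (hi : i ≤ k) : bb γ k i ≤ 1 := by
  induction hi using Nat.decreasingInduction with
  | self => rw [bb_self]
  | of_succ i hi ih =>
    have h1 := bb_step γ k i hi
    have h2 := bb_fact γ d k i hi hkd (hlow i hi)
    have h3 := bb_nonneg γ k (i+1) hγ
    have h4 : (0:ℝ) ≤ ((k - i : ℕ) : ℝ) := by positivity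
    have h5 := hγ i hi
    nlinarith

theorem bb_lt_one (γ : ℕ → ℝ) (d k : ℕ) (hkd : k < d) (hγ : ∀ a < k, γ a ≤ 1)
    (hlow : ∀ a < k, -1 ≤ ((d : ℝ) - a) * γ a) (i : ℕ) (hi : i < k) : bb γ k i < 1 := by
  have h1 := bb_step γ k i hi
  have h2 := bb_fact γ d k i hi hkd (hlow i hi)
  have h3 := bb_nonneg γ k (i+1) hγ
  have h6 := bb_le_one γ d k hkd hγ hlow (i+1) hi
  have h4 : (0:ℝ) ≤ ((k - i : ℕ) : ℝ) := by positivity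
  have h5 : 0 ≤ ((k - i : ℕ) : ℝ) * (1 - γ i) := mul_nonneg h4 (by linarith [hγ i hi])
  nlinarith

theorem bb_mono (γ : ℕ → ℝ) (d k : ℕ) (hkd : k < d) (hγ : ∀ a < k, γ a ≤ 1)
    (hlow : ∀ a < k, -1 ≤ ((d : ℝ) - a) * γ a) (i : ℕ) (hi : i < k) :
    bb γ k i ≤ bb γ k (i + 1) := by
  have h1 := bb_step γ k i hi
  have h2 := bb_fact γ d k i hi hkd (hlow i hi)
  have h3 := bb_nonneg γ k (i+1) hγ
  have h4 : (0:ℝ) ≤ ((k - i : ℕ) : ℝ) := by positivity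
  nlinarith

theorem abel_aux (k : ℕ) (t e : ℕ → ℝ) (ht : ∀ i, i + 1 < k → t i ≤ t (i + 1))
    (he : ∀ i < k, 0 ≤ e i) (hpos : ∀ i < k, 0 ≤ t i) (hek : e k = 0) :
    0 ≤ ∑ i ∈ range k, t i * (e i - e (i + 1)) := by
  have key : ∀ m, m < k → 0 ≤ ∑ i ∈ range (m + 1), t i * (e i - e (i + 1)) + t m * e (m + 1) := by
    intro m
    induction m with
    | zero =>
      intro h
      simp
      nlinarith [mul_nonneg (hpos 0 h) (he 0 h)]
    | succ m ih =>
      intro h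
      rw [Finset.sum_range_succ]
      have h1 := ih (by omega)
      have h2 := ht m h
      have h3 := he (m+1) h
      nlinarith
  rcases k with _ | m
  · simp
  · have := key m (by omega)
    rwa [hek, mul_zero, add_zero] at this

section abstract
variable {E : ℕ → Type*} [∀ c, NormedAddCommGroup (E c)] [∀ c, InnerProductSpace ℝ (E c)]
  [∀ c, FiniteDimensional ℝ (E c)]

/-- squared norm of the projection -/
def pp (L : (c : ℕ) → ℕ → Submodule ℝ (E c)) (c i : ℕ) (x : E c) : ℝ :=
  ‖(L c i).starProjection x‖ ^ 2

theorem starProj_comp {F : Type*} [NormedAddCommGroup F] [InnerProductSpace ℝ F]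
    [FiniteDimensional ℝ F] (A B : Submodule ℝ F) (h : A ≤ B) (x : F) :
    A.starProjection (B.starProjection x) = A.starProjection x := by
  symm
  apply Submodule.eq_starProjection_of_mem_of_inner_eq_zero
  · exact Submodule.starProjection_apply_mem _ _
  · intro w hw
    have h1 := Submodule.starProjection_inner_eq_zero (K := A) (B.starProjection x) w hw
    have h2 := Submodule.starProjection_inner_eq_zero (K := B) x w (h hw)
    have : x - A.starProjection (B.starProjection x) =
      (x - B.starProjection x) + (B.starProjection x - A.starProjection (B.starProjection x)) := by
      abel
    rw [this, inner_add_left, h1, h2, add_zero]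

theorem starProj_bot {F : Type*} [NormedAddCommGroup F] [InnerProductSpace ℝ F]
    [FiniteDimensional ℝ F] (A : Submodule ℝ F) (h : A = ⊥) (x : F) :
    A.starProjection x = 0 := by
  subst h; simp

theorem starProj_inner_self {F : Type*} [NormedAddCommGroup F] [InnerProductSpace ℝ F]
    [FiniteDimensional ℝ F] (A : Submodule ℝ F) (x y : F) (hy : y ∈ A) :
    inner ℝ (A.starProjection x) y = inner ℝ x y := by
  have h1 := Submodule.starProjection_inner_eq_zero (K := A) x y hy
  rw [inner_sub_left] at h1
  linarith

/-- difference of projections -/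
theorem diff_norm {F : Type*} [NormedAddCommGroup F] [InnerProductSpace ℝ F]
    [FiniteDimensional ℝ F] (A B : Submodule ℝ F) (h : A ≤ B) (x : F) :
    ‖B.starProjection x - A.starProjection x‖ ^ 2
      = ‖B.starProjection x‖ ^ 2 - ‖A.starProjection x‖ ^ 2 := by
  have h1 : inner ℝ (B.starProjection x) (A.starProjection x) = ‖A.starProjection x‖ ^ 2 := by
    rw [← real_inner_self_eq_norm_sq,
      starProj_inner_self B x _ (h (Submodule.starProjection_apply_mem _ _)),
      starProj_inner_self A x _ (Submodule.starProjection_apply_mem _ _)]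
  rw [norm_sub_sq_real, h1]; ring

theorem diff_inner {F : Type*} [NormedAddCommGroup F] [InnerProductSpace ℝ F]
    [FiniteDimensional ℝ F] (A B : Submodule ℝ F) (h : A ≤ B) (x y : F) :
    inner ℝ (B.starProjection x - A.starProjection x) y
      = inner ℝ (B.starProjection x - A.starProjection x)
          (B.starProjection y - A.starProjection y) := by
  have hm : ∀ z : F, B.starProjection z ∈ B := fun z => Submodule.starProjection_apply_mem _ _
  have hn : ∀ z : F, A.starProjection z ∈ A := fun z => Submodule.starProjection_apply_mem _ _
  have e1 : inner ℝ (B.starProjection x) (B.starProjection y) = inner ℝ (B.starProjection x) y := by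
    rw [real_inner_comm, starProj_inner_self B _ _ (hm x), real_inner_comm]
  have e2 : inner ℝ (A.starProjection x) (A.starProjection y) = inner ℝ (A.starProjection x) y := by
    rw [real_inner_comm, starProj_inner_self A _ _ (hn x), real_inner_comm]
  have e3 : inner ℝ (A.starProjection x) (B.starProjection y) = inner ℝ (A.starProjection x) y := by
    rw [real_inner_comm, starProj_inner_self B _ _ (h (hn x)), real_inner_comm]
  have e4 : inner ℝ (B.starProjection x) (A.starProjection y) = inner ℝ (A.starProjection x) y := by
    rw [starProj_inner_self B _ _ (h (hn y)), ← starProj_inner_self A _ _ (hn y), e2]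
  simp only [inner_sub_left, inner_sub_right, e1, e2, e3, e4]
  ring

theorem abs_N (L : (c : ℕ) → ℕ → Submodule ℝ (E c))
    (U : (c : ℕ) → E c →ₗ[ℝ] E (c + 1)) (D : (c : ℕ) → E (c + 1) → E c)
    (hadj : ∀ c x y, inner ℝ (U c x) y = inner ℝ x (D c y))
    (hbot : ∀ c, L c c = ⊥) (hanti : ∀ c i, i + 1 ≤ c → L c (i + 1) ≤ L c i)
    (hD : ∀ c i, i ≤ c → ∀ y ∈ L (c + 1) i, D c y ∈ L c i)
    (k : ℕ) (s : ℕ → ℝ) (hs : ∀ i < k, 0 < s i) (hsm : ∀ i, i + 1 < k → s (i + 1) ≤ s i)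
    (hsk : s k = 0)
    (hU : ∀ h ∈ L k 0, ‖U k h‖ ^ 2 ≤ ∑ j ∈ range k, s j * (pp L k j h - pp L k (j + 1) h))
    (f : E (k + 1)) (hf : f ∈ L (k + 1) 0) :
    ‖D k f‖ ^ 2 ≤ ∑ i ∈ range (k + 1), s i * (pp L (k + 1) i f - pp L (k + 1) (i + 1) f) := by
  have hanti' : ∀ c i j, i ≤ j → j ≤ c → L c j ≤ L c i := by
    intro c i j hij
    induction j, hij using Nat.le_induction with
    | base => intro _; exact le_rfl
    | succ j hij ih => intro hj; exact (hanti c j hj).trans (ih (by omega))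
  set g := D k f with hg
  have hgL : g ∈ L k 0 := hD k 0 (by omega) f hf
  -- projection compat
  have hproj : ∀ i ≤ k, (L (k+1) i).starProjection (U k g)
      = (L (k+1) i).starProjection (U k ((L k i).starProjection g)) := by
    intro i hi
    apply Submodule.eq_starProjection_of_mem_of_inner_eq_zero
    · exact Submodule.starProjection_apply_mem _ _
    · intro w hw
      have h1 := Submodule.starProjection_inner_eq_zero (K := L (k+1) i) (U k g) w hw
      have h2 := Submodule.starProjection_inner_eq_zero (K := L k i) g _ (hD k i hi w hw)
      have h3 := Submodule.starProjection_inner_eq_zero (K := L (k+1) i)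
        (U k ((L k i).starProjection g)) w hw
      rw [← hadj, map_sub] at h2
      rw [inner_sub_left] at *
      linarith
  have hp : ∀ i ≤ k, pp L (k+1) i (U k g) ≤ ‖U k ((L k i).starProjection g)‖ ^ 2 := by
    intro i hi
    unfold pp
    rw [hproj i hi]
    have := Submodule.norm_starProjection_apply_le (L (k+1) i) (U k ((L k i).starProjection g))
    gcongr
  have hpk : pp L (k+1) k (U k g) = 0 := by
    have h1 := hp k le_rfl
    rw [starProj_bot _ (hbot k)] at h1
    simp at h1
    exact le_antisymm h1 (by unfold pp; positivity)
  -- sums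
  set n : ℕ → ℝ := fun j => pp L k j g - pp L k (j + 1) g with hn
  have hp2 : ∀ i < k, pp L (k+1) i (U k g) ≤ ∑ j ∈ Ico i k, s j * n j := by
    intro i hi
    refine (hp i hi.le).trans ?_
    refine (hU _ (hanti' k 0 i (by omega) hi.le (Submodule.starProjection_apply_mem _ _))).trans ?_
    rw [Finset.range_eq_Ico, ← Finset.sum_Ico_consecutive _ (Nat.zero_le i) hi.le]
    have hz : ∑ j ∈ Ico 0 i, s j * (pp L k j ((L k i).starProjection g)
        - pp L k (j + 1) ((L k i).starProjection g)) = 0 := by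
      apply Finset.sum_eq_zero
      intro j hj
      have hj := (Finset.mem_Ico.1 hj).2
      have hself : ∀ j ≤ i, (L k j).starProjection ((L k i).starProjection g)
          = (L k i).starProjection g := by
        intro j hj
        rw [Submodule.starProjection_eq_self_iff]
        exact hanti' k j i hj hi.le (Submodule.starProjection_apply_mem _ _)
      unfold pp
      rw [hself j hj.le, hself (j+1) hj]
      simp
    rw [hz, zero_add]
    apply le_of_eq
    apply Finset.sum_congr rfl
    intro j hj
    have hj := Finset.mem_Ico.1 hj
    simp only [hn, pp]
    rw [starProj_comp _ _ (hanti' k i j hj.1 hj.2.le), starProj_comp _ _ (hanti' k i (j+1) (by omega) hj.2)]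
  have hab := abel_aux k (fun i => (s i)⁻¹)
    (fun i => ∑ j ∈ Ico i k, s j * n j - pp L (k+1) i (U k g))
    (fun i hi => by
      have := hs (i+1) hi
      have := hsm i hi
      gcongr)
    (fun i hi => by have := hp2 i hi; linarith)
    (fun i hi => (inv_pos.2 (hs i hi)).le)
    (by simp [hpk])
  have hsum : ∑ i ∈ range k, (s i)⁻¹ * (pp L (k+1) i (U k g) - pp L (k+1) (i+1) (U k g))
      ≤ ∑ i ∈ range k, n i := by
    have : ∑ i ∈ range k, n i - ∑ i ∈ range k, (s i)⁻¹ * (pp L (k+1) i (U k g) - pp L (k+1) (i+1) (U k g)) =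
       ∑ i ∈ range k, (s i)⁻¹ *
        ((∑ j ∈ Ico i k, s j * n j - pp L (k + 1) i ((U k) g)) -
          (∑ j ∈ Ico (i + 1) k, s j * n j - pp L (k + 1) (i + 1) ((U k) g))) := by
      rw [← Finset.sum_sub_distrib]
      apply Finset.sum_congr rfl
      intro i hi
      have hi := Finset.mem_range.1 hi
      rw [Finset.sum_eq_sum_Ico_succ_bot hi]
      have := (hs i hi).ne'
      field_simp
      ring
    linarith
  have htel : ∑ i ∈ range k, n i = ‖g‖ ^ 2 := by
    rw [Finset.sum_range_sub']
    unfold pp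
    rw [starProj_bot _ (hbot k), Submodule.starProjection_eq_self_iff.2 hgL]
    simp
  have hftel : ∑ i ∈ range (k+1), ((L (k+1) i).starProjection f - (L (k+1) (i+1)).starProjection f) = f := by
    rw [Finset.sum_range_sub', starProj_bot _ (hbot (k+1)), Submodule.starProjection_eq_self_iff.2 hf]
    simp
  have hgg : ‖g‖ ^ 2 = ∑ i ∈ range k, inner ℝ ((L (k+1) i).starProjection f - (L (k+1) (i+1)).starProjection f) (U k g) := by
    have h1 : ‖g‖^2 = inner ℝ f (U k g) := by
      rw [real_inner_comm, hadj, ← hg, real_inner_self_eq_norm_sq]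
    have h2 : inner ℝ ((L (k+1) k).starProjection f - (L (k+1) (k+1)).starProjection f) (U k g) = 0 := by
      rw [diff_inner _ _ (hanti (k+1) k le_rfl)]
      have h3 : (L (k+1) k).starProjection (U k g) = 0 := by
        unfold pp at hpk
        simpa using hpk
      rw [h3, starProj_bot _ (hbot (k+1)) (U k g)]
      simp
    rw [h1]
    conv_lhs => rw [← hftel]
    rw [sum_inner, Finset.sum_range_succ, h2, add_zero]
  have hamgm : ∀ i ∈ range k, 2 * inner ℝ ((L (k+1) i).starProjection f - (L (k+1) (i+1)).starProjection f) (U k g)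
      ≤ s i * (pp L (k + 1) i f - pp L (k + 1) (i + 1) f)
        + (s i)⁻¹ * (pp L (k+1) i (U k g) - pp L (k+1) (i+1) (U k g)) := by
    intro i hi
    have hi := Finset.mem_range.1 hi
    have hle := hanti (k+1) i (by omega)
    rw [diff_inner _ _ hle]
    unfold pp
    rw [← diff_norm _ _ hle, ← diff_norm _ _ hle]
    set a := (L (k+1) i).starProjection f - (L (k+1) (i+1)).starProjection f
    set b := (L (k+1) i).starProjection (U k g) - (L (k+1) (i+1)).starProjection (U k g)
    have h0 := hs i hi
    have h1 : 0 ≤ ‖s i • a - b‖ ^ 2 := by positivity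
    rw [norm_sub_sq_real, norm_smul, inner_smul_left, Real.norm_of_nonneg h0.le] at h1
    simp only [conj_trivial] at h1
    have h2 : 0 ≤ (s i)⁻¹ * ((s i * ‖a‖) ^ 2 - 2 * (s i * inner ℝ a b) + ‖b‖ ^ 2) :=
      mul_nonneg (inv_pos.2 h0).le h1
    have h3 : (s i)⁻¹ * ((s i * ‖a‖) ^ 2 - 2 * (s i * inner ℝ a b) + ‖b‖ ^ 2)
       = s i * ‖a‖ ^ 2 - 2 * inner ℝ a b + (s i)⁻¹ * ‖b‖^2 := by
      field_simp
    linarith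
  have hfin := Finset.sum_le_sum hamgm
  rw [← Finset.mul_sum, ← hgg, Finset.sum_add_distrib] at hfin
  rw [Finset.sum_range_succ, hsk, zero_mul, add_zero]
  linarith

theorem abs_T (L : (c : ℕ) → ℕ → Submodule ℝ (E c))
    (U : (c : ℕ) → E c →ₗ[ℝ] E (c + 1)) (D : (c : ℕ) → E (c + 1) → E c)
    (hadj : ∀ c x y, inner ℝ (U c x) y = inner ℝ x (D c y))
    (hbot : ∀ c, L c c = ⊥) (hanti : ∀ c i, i + 1 ≤ c → L c (i + 1) ≤ L c i)
    (hD : ∀ c i, i ≤ c → ∀ y ∈ L (c + 1) i, D c y ∈ L c i)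
    (d : ℕ) (γ : ℕ → ℝ) (hγ : ∀ a < d, γ a ≤ 1)
    (hlow : ∀ a < d, -1 ≤ ((d : ℝ) - a) * γ a)
    (hA : ∀ k < d, ∀ f : E (k + 1), (1 - γ k) * (‖f‖ ^ 2 - ‖D k f‖ ^ 2) ≤
      ((k : ℝ) + 2) / (k + 1) * (‖f‖ ^ 2 - ‖U (k + 1) f‖ ^ 2))
    (k : ℕ) (hk : k < d) (f : E (k + 1)) (hf : f ∈ L (k + 1) 0) :
    ∑ i ∈ range (k + 1), ((1 - γ k) * bb γ k i) * (pp L (k + 1) i f - pp L (k + 1) (i + 1) f)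
      ≤ ((k : ℝ) + 2) / (k + 1) * (‖f‖ ^ 2 - ‖U (k + 1) f‖ ^ 2) := by
  have htel : ∀ c, ∀ h ∈ L c 0, ‖h‖ ^ 2 = ∑ j ∈ range c, (pp L c j h - pp L c (j + 1) h) := by
    intro c h hh
    rw [Finset.sum_range_sub']
    unfold pp
    rw [starProj_bot _ (hbot c), Submodule.starProjection_eq_self_iff.2 hh]
    simp
  induction k with
  | zero =>
    refine le_trans ?_ (hA 0 hk f)
    have hD0 : D 0 f = 0 := by
      have := hD 0 0 le_rfl f hf
      rw [hbot 0] at this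
      simpa using this
    rw [hD0, htel 1 f hf]
    simp [bb_self]
  | succ m ih =>
    have hγ' : ∀ a < m + 1, γ a ≤ 1 := fun a ha => hγ a (by omega)
    have hlow' : ∀ a < m + 1, -1 ≤ ((d : ℝ) - a) * γ a := fun a ha => hlow a (by omega)
    have hN := abs_N L U D hadj hbot hanti hD (m + 1) (fun i => 1 - bb γ (m + 1) i)
      (fun i hi => by have := bb_lt_one γ d (m+1) hk hγ' hlow' i hi; linarith)
      (fun i hi => by have := bb_mono γ d (m+1) hk hγ' hlow' i (by omega); linarith)
      (by simp [bb_self])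
      (by
        intro h hh
        have h1 := ih (by omega) h hh
        have h2 : ‖U (m+1) h‖ ^ 2 ≤ ‖h‖ ^ 2 - ((m:ℝ) + 1) / (m + 2) *
          ∑ i ∈ range (m + 1), ((1 - γ m) * bb γ m i) * (pp L (m + 1) i h - pp L (m + 1) (i + 1) h) := by
          have h3 : ((m:ℝ) + 1) / (m + 2) *
            ∑ i ∈ range (m + 1), ((1 - γ m) * bb γ m i) * (pp L (m + 1) i h - pp L (m + 1) (i + 1) h)
            ≤ ((m:ℝ) + 1) / (m + 2) * (((m : ℝ) + 2) / (m + 1) * (‖h‖ ^ 2 - ‖U (m + 1) h‖ ^ 2)) :=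
            mul_le_mul_of_nonneg_left h1 (by positivity)
          have h4 : ((m:ℝ) + 1) / (m + 2) * (((m : ℝ) + 2) / (m + 1) * (‖h‖ ^ 2 - ‖U (m + 1) h‖ ^ 2))
            = ‖h‖ ^ 2 - ‖U (m + 1) h‖ ^ 2 := by field_simp
          linarith
        refine h2.trans ?_
        rw [htel _ h hh, Finset.mul_sum, ← Finset.sum_sub_distrib]
        apply Finset.sum_le_sum
        intro i hi
        have hi := Finset.mem_range.1 hi
        have hn : 0 ≤ pp L (m + 1) i h - pp L (m + 1) (i + 1) h := by
          unfold pp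
          rw [← diff_norm _ _ (hanti (m+1) i hi)]
          positivity
        have hb : bb γ (m+1) i ≤ ((m:ℝ) + 1) / (m + 2) * ((1 - γ m) * bb γ m i) := by
          unfold bb
          rw [Finset.prod_Ico_succ_top (by omega)]
          obtain ⟨j, rfl⟩ : ∃ j, m = i + j := ⟨m - i, by omega⟩
          have e1 : i + j + 1 - i = j + 1 := by omega
          have e2 : i + j - i = j := by omega
          rw [e1, e2]
          have hP : 0 ≤ (∏ a ∈ Ico i (i + j), (1 - γ a)) * (1 - γ (i + j)) := by
            rw [← Finset.prod_Ico_succ_top (by omega)]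
            apply Finset.prod_nonneg
            intro a ha
            have := hγ' a (Finset.mem_Ico.1 ha).2
            linarith
          have hc : (((j + 1 : ℕ) : ℝ) + 1)⁻¹ ≤ (((i + j : ℕ) : ℝ) + 1) / (((i + j : ℕ) : ℝ) + 2) * ((j : ℝ) + 1)⁻¹ := by
            push_cast
            rw [← one_div, ← div_eq_mul_inv, div_div, div_le_div_iff₀ (by positivity) (by positivity)]
            have : (0:ℝ) ≤ i := by positivity
            nlinarith
          calc _ ≤ _ := mul_le_mul_of_nonneg_right hc hP
            _ = _ := by ring
        nlinarith)
      f hf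
    refine le_trans ?_ (hA (m+1) hk f)
    have h1 : ∑ i ∈ range (m + 1 + 1), (1 - γ (m + 1)) * bb γ (m + 1) i * (pp L (m + 1 + 1) i f - pp L (m + 1 + 1) (i + 1) f)
      = (1 - γ (m+1)) * (‖f‖^2 - ∑ i ∈ range (m + 1 + 1), (1 - bb γ (m+1) i) * (pp L (m + 1 + 1) i f - pp L (m + 1 + 1) (i + 1) f)) := by
      rw [htel _ f hf, ← Finset.sum_sub_distrib, Finset.mul_sum]
      apply Finset.sum_congr rfl
      intros; ring
    rw [h1]
    apply mul_le_mul_of_nonneg_left _ (by linarith [hγ (m+1) hk])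
    linarith

theorem abs_main (L : (c : ℕ) → ℕ → Submodule ℝ (E c))
    (U : (c : ℕ) → E c →ₗ[ℝ] E (c + 1)) (D : (c : ℕ) → E (c + 1) → E c)
    (hadj : ∀ c x y, inner ℝ (U c x) y = inner ℝ x (D c y))
    (hbot : ∀ c, L c c = ⊥) (hanti : ∀ c i, i + 1 ≤ c → L c (i + 1) ≤ L c i)
    (hD : ∀ c i, i ≤ c → ∀ y ∈ L (c + 1) i, D c y ∈ L c i)
    (d : ℕ) (γ : ℕ → ℝ) (hγ : ∀ a < d, γ a ≤ 1)
    (hlow : ∀ a < d, -1 ≤ ((d : ℝ) - a) * γ a)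
    (hA : ∀ k < d, ∀ f : E (k + 1), (1 - γ k) * (‖f‖ ^ 2 - ‖D k f‖ ^ 2) ≤
      ((k : ℝ) + 2) / (k + 1) * (‖f‖ ^ 2 - ‖U (k + 1) f‖ ^ 2))
    (k : ℕ) (hk : k < d) (f : ℕ → E (k + 1)) (hf : ∀ i ≤ k, f i ∈ L (k + 1) i)
    (hf' : ∀ i ≤ k, ∀ y ∈ L (k + 1) (i + 1), inner ℝ (f i) y = 0) :
    ‖∑ i ∈ range (k + 1), f i‖ ^ 2 - ((k : ℝ) + 2) / (k + 1) *
      (‖∑ i ∈ range (k + 1), f i‖ ^ 2 - ‖U (k + 1) (∑ i ∈ range (k + 1), f i)‖ ^ 2)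
    ≤ ∑ i ∈ range (k + 1), (1 - (((k - i : ℕ) : ℝ) + 1)⁻¹ * ∏ a ∈ Finset.Icc i k, (1 - γ a)) * ‖f i‖ ^ 2 := by
  have hanti' : ∀ c i j, i ≤ j → j ≤ c → L c j ≤ L c i := by
    intro c i j hij
    induction j, hij using Nat.le_induction with
    | base => intro _; exact le_rfl
    | succ j hij ih => intro hj; exact (hanti c j hj).trans (ih (by omega))
  set F := ∑ i ∈ range (k + 1), f i with hF
  have hFL : F ∈ L (k+1) 0 := by
    apply Submodule.sum_mem
    intro i hi
    have hi := Finset.mem_range.1 hi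
    exact hanti' (k+1) 0 i (by omega) (by omega) (hf i (by omega))
  have hPF : ∀ j ≤ k + 1, (L (k+1) j).starProjection F = ∑ i ∈ Ico j (k+1), f i := by
    intro j hj
    apply Submodule.eq_starProjection_of_mem_of_inner_eq_zero
    · apply Submodule.sum_mem
      intro i hi
      have hi := Finset.mem_Ico.1 hi
      exact hanti' (k+1) j i (by omega) (by omega) (hf i (by omega))
    · intro y hy
      have : F - ∑ i ∈ Ico j (k+1), f i = ∑ i ∈ Ico 0 j, f i := by
        rw [hF, Finset.range_eq_Ico, ← Finset.sum_Ico_consecutive _ (Nat.zero_le j) hj]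
        abel
      rw [this, sum_inner]
      apply Finset.sum_eq_zero
      intro i hi
      have hi := Finset.mem_Ico.1 hi
      exact hf' i (by omega) y (hanti' (k+1) (i+1) j (by omega) hj hy)
  have hn : ∀ i < k + 1, pp L (k+1) i F - pp L (k+1) (i+1) F = ‖f i‖ ^ 2 := by
    intro i hi
    unfold pp
    rw [← diff_norm _ _ (hanti (k+1) i hi), hPF i hi.le, hPF (i+1) hi,
      Finset.sum_eq_sum_Ico_succ_bot hi]
    simp
  have hT := abs_T L U D hadj hbot hanti hD d γ hγ hlow hA k hk F hFL
  have hnorm : ‖F‖ ^ 2 = ∑ i ∈ range (k+1), ‖f i‖ ^ 2 := by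
    rw [← Finset.sum_congr rfl (fun i hi => hn i (Finset.mem_range.1 hi)), Finset.sum_range_sub']
    unfold pp
    rw [starProj_bot _ (hbot (k+1)), Submodule.starProjection_eq_self_iff.2 hFL]
    simp
  have hR : ∑ i ∈ range (k + 1), (1 - (((k - i : ℕ) : ℝ) + 1)⁻¹ * ∏ a ∈ Finset.Icc i k, (1 - γ a)) * ‖f i‖ ^ 2
     = ‖F‖ ^ 2 - ∑ i ∈ range (k + 1), ((1 - γ k) * bb γ k i) * (pp L (k + 1) i F - pp L (k + 1) (i + 1) F) := by
    rw [hnorm, ← Finset.sum_sub_distrib]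
    apply Finset.sum_congr rfl
    intro i hi
    have hi := Finset.mem_range.1 hi
    rw [hn i hi]
    unfold bb
    have : Finset.Icc i k = Finset.Ico i (k+1) := by ext; simp
    rw [this, Finset.prod_Ico_succ_top (by omega)]
    ring
  rw [hR]
  linarith

end abstract

namespace WSC

/-- vertices extending a face -/
def nb (X : WSC V d) (σ : Finset V) : Finset V :=
  Finset.univ.filter fun v => v ∉ σ ∧ insert v σ ∈ X.faces

theorem mem_nb {X : WSC V d} {σ : Finset V} {v : V} :
    v ∈ X.nb σ ↔ v ∉ σ ∧ insert v σ ∈ X.faces := by simp [nb]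

theorem mem_dF {X : WSC V d} {σ : Finset V} {c : ℕ} :
    σ ∈ X.toWFam.dimFaces c ↔ σ ∈ X.faces ∧ σ.card = c := by simp [WFam.dimFaces]

theorem wpos {X : WSC V d} {σ : Finset V} {c : ℕ} (h : σ ∈ X.toWFam.dimFaces c) : 0 < X.w σ :=
  X.w_pos σ (mem_dF.1 h).1

theorem ins_mem {X : WSC V d} {σ : Finset V} {c : ℕ} {v : V} (h : σ ∈ X.toWFam.dimFaces c)
    (hv : v ∈ X.nb σ) : insert v σ ∈ X.toWFam.dimFaces (c + 1) := by
  rw [mem_dF] at *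
  rw [mem_nb] at hv
  exact ⟨hv.2, by rw [Finset.card_insert_of_notMem hv.1, h.2]⟩

theorem erase_mem {X : WSC V d} {ρ : Finset V} {c : ℕ} {v : V}
    (h : ρ ∈ X.toWFam.dimFaces (c + 1)) (hv : v ∈ ρ) : ρ.erase v ∈ X.toWFam.dimFaces c := by
  rw [mem_dF] at *
  exact ⟨X.down_closed h.1 (Finset.erase_subset _ _), by rw [Finset.card_erase_of_mem hv, h.2]; rfl⟩

theorem swap (X : WSC V d) (c : ℕ) (F : Finset V → V → ℝ) :
    ∑ ρ ∈ X.toWFam.dimFaces (c + 1), ∑ v ∈ ρ, F ρ v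
      = ∑ σ ∈ X.toWFam.dimFaces c, ∑ v ∈ X.nb σ, F (insert v σ) v := by
  rw [Finset.sum_sigma', Finset.sum_sigma']
  refine Finset.sum_bij' (fun x _ => ⟨x.1.erase x.2, x.2⟩) (fun x _ => ⟨insert x.2 x.1, x.2⟩) ?_ ?_ ?_ ?_ ?_
  · rintro ⟨ρ, v⟩ h
    simp only [Finset.mem_sigma] at h ⊢
    refine ⟨erase_mem h.1 h.2, mem_nb.2 ⟨by simp, ?_⟩⟩
    rw [Finset.insert_erase h.2]
    exact (mem_dF.1 h.1).1
  · rintro ⟨σ, v⟩ h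
    simp only [Finset.mem_sigma] at h ⊢
    exact ⟨ins_mem h.1 h.2, by simp⟩
  · rintro ⟨ρ, v⟩ h
    simp only [Finset.mem_sigma] at h
    simp [Finset.insert_erase h.2]
  · rintro ⟨σ, v⟩ h
    simp only [Finset.mem_sigma] at h
    simp [Finset.erase_insert (mem_nb.1 h.2).1]
  · rintro ⟨ρ, v⟩ h
    simp only [Finset.mem_sigma] at h
    simp [Finset.insert_erase h.2]

/-- `w_down` in a uniform form -/
theorem w_top (X : WSC V d) {c : ℕ} {σ : Finset V} (h : σ ∈ X.toWFam.dimFaces c) (hc : c ≤ d + 1) :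
    ((d + 1).choose c : ℝ) * X.w σ =
      ∑ ρ ∈ (X.toWFam.dimFaces (d + 1)).filter (fun ρ => σ ⊆ ρ), X.w ρ := by
  have hm := mem_dF.1 h
  by_cases hcd : c ≤ d
  · have h1 := X.w_down σ hm.1 (by omega)
    rw [hm.2] at h1
    have h2 : ((d + 1).choose c : ℝ) ≠ 0 := by
      exact_mod_cast (Nat.choose_pos hc).ne'
    rw [h1]
    field_simp
    simp [WFam.dimFaces, Finset.filter_filter]
  · obtain rfl : c = d + 1 := by omega
    have : (X.toWFam.dimFaces (d + 1)).filter (fun ρ => σ ⊆ ρ) = {σ} := by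
      ext ρ
      simp only [Finset.mem_filter, Finset.mem_singleton, mem_dF]
      constructor
      · rintro ⟨⟨h1, h2⟩, h3⟩
        exact (Finset.eq_of_subset_of_card_le h3 (by omega)).symm
      · rintro rfl
        exact ⟨hm, le_rfl⟩
    rw [this]
    simp

theorem choose_rel (c : ℕ) (hc : c ≤ d) :
    ((d + 1).choose (c + 1) : ℝ) * (c + 1) = (d + 1).choose c * ((d : ℝ) + 1 - c) := by
  have := Nat.choose_succ_right_eq (d + 1) c
  have h2 : ((d + 1 - c : ℕ) : ℝ) = (d : ℝ) + 1 - c := by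
    rw [Nat.cast_sub (by omega)]; push_cast; ring
  rw [← h2]
  exact_mod_cast this

theorem wrec (X : WSC V d) {c : ℕ} {σ : Finset V} (h : σ ∈ X.toWFam.dimFaces c) (hc : c ≤ d) :
    ∑ v ∈ X.nb σ, X.w (insert v σ) = ((c : ℝ) + 1) * X.w σ := by
  have hcp : (0 : ℝ) < ((d + 1).choose (c + 1) : ℝ) := by
    exact_mod_cast Nat.choose_pos (by omega)
  have hm := mem_dF.1 h
  apply mul_left_cancel₀ hcp.ne'
  have h1 : ((d + 1).choose (c + 1) : ℝ) * (((c : ℝ) + 1) * X.w σ)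
      = ((d : ℝ) + 1 - c) * (((d + 1).choose c : ℝ) * X.w σ) := by
    rw [← mul_assoc, choose_rel c hc]; ring
  rw [h1, w_top X h (by omega), Finset.mul_sum, Finset.mul_sum]
  rw [Finset.sum_congr rfl (fun v hv => w_top X (ins_mem h hv) (by omega))]
  rw [Finset.sum_comm' (s' := fun ρ => ρ \ σ)
    (t' := (X.toWFam.dimFaces (d + 1)).filter (fun ρ => σ ⊆ ρ))]
  · apply Finset.sum_congr rfl
    intro ρ hρ
    simp only [Finset.mem_filter, mem_dF] at hρ
    rw [Finset.sum_const, nsmul_eq_mul, Finset.card_sdiff_of_subset hρ.2, hρ.1.2, hm.2,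
      Nat.cast_sub (by omega)]
    push_cast; ring
  · intro v ρ
    simp only [Finset.mem_filter, mem_dF, mem_nb, Finset.mem_sdiff, Finset.insert_subset_iff]
    constructor
    · rintro ⟨⟨h1, h2⟩, h3, h4, h5⟩
      exact ⟨⟨h4, h1⟩, h3, h5⟩
    · rintro ⟨⟨h4, h1⟩, h3, h5⟩
      exact ⟨⟨h1, X.down_closed h3.1 (Finset.insert_subset h4 h5)⟩, h3, h4, h5⟩

theorem w_step (X : WSC V d) {c : ℕ} {σ : Finset V} {v : V} (h : σ ∈ X.toWFam.dimFaces c)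
    (hc : c ≤ d) (hv : v ∈ X.nb σ) :
    ((d : ℝ) + 1 - c) * X.w (insert v σ) ≤ ((c : ℝ) + 1) * X.w σ := by
  have hcp : (0 : ℝ) < ((d + 1).choose c : ℝ) := by
    exact_mod_cast Nat.choose_pos (by omega)
  have h1 := w_top X h (by omega)
  have h2 := w_top X (ins_mem h hv) (by omega)
  have h3 : ((d + 1).choose (c + 1) : ℝ) * X.w (insert v σ) ≤ ((d + 1).choose c : ℝ) * X.w σ := by
    rw [h1, h2]
    apply Finset.sum_le_sum_of_subset_of_nonneg
    · intro ρ
      simp only [Finset.mem_filter, Finset.insert_subset_iff]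
      tauto
    · intro ρ hρ _
      exact (wpos (Finset.mem_filter.1 hρ).1).le
  have h4 := choose_rel c hc
  have h5 : (0:ℝ) ≤ (c:ℝ) + 1 := by positivity
  have h6 := mul_le_mul_of_nonneg_left h3 h5
  have h7 : ((c:ℝ) + 1) * (((d + 1).choose (c + 1) : ℝ) * X.w (insert v σ))
     = ((d + 1).choose c : ℝ) * (((d : ℝ) + 1 - c) * X.w (insert v σ)) := by
    rw [← mul_assoc, mul_comm ((c:ℝ)+1), h4]; ring
  rw [h7] at h6
  have h8 : ((c:ℝ) + 1) * (((d + 1).choose c : ℝ) * X.w σ) = ((d + 1).choose c : ℝ) * (((c:ℝ)+1) * X.w σ) := by ring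
  rw [h8] at h6
  exact le_of_mul_le_mul_left h6 hcp

theorem sDiff_eq (c : ℕ) (f : Finset V → ℝ) (ρ : Finset V) (h : ρ.card = c + 1) :
    sDiff c f ρ = ((c : ℝ) + 1)⁻¹ * ∑ v ∈ ρ, f (ρ.erase v) := by
  unfold sDiff
  congr 1
  symm
  apply Finset.sum_nbij (fun v => ρ.erase v)
  · intro v hv
    simp only [Finset.mem_filter, Finset.mem_powerset]
    exact ⟨Finset.erase_subset _ _, by rw [Finset.card_erase_of_mem hv, h]; rfl⟩
  · exact Finset.erase_injOn ρ
  · intro τ hτ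
    simp only [Finset.coe_filter, Finset.mem_powerset, Set.mem_ofPred_eq] at hτ
    obtain ⟨a, ha, rfl⟩ := Finset.exists_eq_insert_iff.2 ⟨hτ.1, by omega⟩
    exact ⟨a, by simp, by simp [Finset.erase_insert ha]⟩
  · intros; rfl

theorem link_w_single (X : WSC V d) {c : ℕ} {σ : Finset V} (h : σ ∈ X.toWFam.dimFaces c) (v : V) :
    (X.toWFam.link σ).w {v} = X.w (insert v σ) / (((c : ℝ) + 1) * X.w σ) := by
  have hm := mem_dF.1 h
  simp only [WFam.link, Finset.card_singleton, hm.2, Finset.singleton_union]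
  congr 2
  rw [Nat.add_comm 1 c, Nat.choose_succ_self_right]
  simp

/-- the nonlazy sum, reindexed -/
theorem nonLazy_eq (X : WSC V d) {c : ℕ} {σ : Finset V} (h : σ ∈ X.toWFam.dimFaces c)
    (f : Finset V → ℝ) :
    X.w σ * X.toWFam.nonLazy c f σ = (c : ℝ)⁻¹ * ((c : ℝ) + 1)⁻¹ *
      ∑ v ∈ X.nb σ, ∑ u ∈ σ, X.w (insert v σ) * f ((insert v σ).erase u) := by
  have hm := mem_dF.1 h
  have hw := (wpos h).ne'
  unfold WFam.nonLazy
  have key : ∑ τ ∈ (X.toWFam.dimFaces c).filter (fun τ => σ ∪ τ ∈ X.toWFam.dimFaces (c + 1)),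
      (X.toWFam.link σ).w (τ \ σ) * f τ
      = ∑ v ∈ X.nb σ, ∑ u ∈ σ, (X.toWFam.link σ).w {v} * f ((insert v σ).erase u) := by
    rw [← Finset.sum_product']
    symm
    apply Finset.sum_nbij (fun p => (insert p.1 σ).erase p.2)
    · rintro ⟨v, u⟩ hp
      simp only [Finset.mem_product] at hp
      have h1 := ins_mem h hp.1
      have hu : u ∈ insert v σ := Finset.mem_insert_of_mem hp.2
      simp only [Finset.mem_filter]
      refine ⟨erase_mem h1 hu, ?_⟩
      convert h1 using 1
      ext x
      simp only [Finset.mem_union, Finset.mem_erase, Finset.mem_insert]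
      have := hp.2
      by_cases hx : x = u
      · subst hx; tauto
      · tauto
    · rintro ⟨v, u⟩ hp ⟨v', u'⟩ hp' heq
      simp only [Finset.coe_product, Set.mem_prod, Finset.mem_coe, mem_nb] at hp hp' heq
      have e1 : v = v' := by
        have : v ∈ (insert v σ).erase u := by
          rw [Finset.mem_erase]
          exact ⟨fun e => hp.1.1 (e ▸ hp.2), by simp⟩
        rw [heq, Finset.mem_erase, Finset.mem_insert] at this
        rcases this.2 with h | h
        · exact h
        · exact absurd h hp.1.1
      subst e1
      have e2 : u = u' := Finset.erase_injOn (insert v σ) (Finset.mem_coe.2 (Finset.mem_insert_of_mem hp.2))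
        (Finset.mem_coe.2 (Finset.mem_insert_of_mem hp'.2)) heq
      rw [e2]
    · intro τ hτ
      simp only [Finset.coe_filter, Set.mem_ofPred_eq, mem_dF] at hτ
      obtain ⟨⟨hτ1, hτ2⟩, hu1, hu2⟩ := hτ
      obtain ⟨v, hv, hv'⟩ := Finset.exists_eq_insert_iff.2
        ⟨(Finset.subset_union_left : σ ⊆ σ ∪ τ), by omega⟩
      obtain ⟨u, hu, hu'⟩ := Finset.exists_eq_insert_iff.2
        ⟨(Finset.subset_union_right : τ ⊆ σ ∪ τ), by omega⟩
      refine ⟨(v, u), ?_, ?_⟩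
      · simp only [Finset.coe_product, Set.mem_prod, Finset.mem_coe, mem_nb]
        refine ⟨⟨hv, hv' ▸ hu1⟩, ?_⟩
        have : u ∈ σ ∪ τ := hu' ▸ Finset.mem_insert_self u τ
        rcases Finset.mem_union.1 this with h | h
        · exact h
        · exact absurd h hu
      · simp only [hv', ← hu', Finset.erase_insert hu]
    · rintro ⟨v, u⟩ hp
      simp only [Finset.mem_product, mem_nb] at hp
      have : (insert v σ).erase u \ σ = {v} := by
        ext x
        simp only [Finset.mem_sdiff, Finset.mem_erase, Finset.mem_insert, Finset.mem_singleton]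
        constructor
        · tauto
        · rintro rfl
          exact ⟨⟨fun e => hp.1.1 (e ▸ hp.2), Or.inl rfl⟩, hp.1.1⟩
      simp only [this]
  rw [key]
  simp only [link_w_single X h, Finset.mul_sum]
  apply Finset.sum_congr rfl
  intro v _
  apply Finset.sum_congr rfl
  intro u _
  have : (c:ℝ) + 1 ≠ 0 := by positivity
  field_simp

theorem Q_eq (X : WSC V d) (c : ℕ) (f : Finset V → ℝ) :
    X.toWFam.inner c (X.toWFam.nonLazy c f) f = (c : ℝ)⁻¹ * ((c : ℝ) + 1)⁻¹ *
      ∑ σ ∈ X.toWFam.dimFaces c, ∑ v ∈ X.nb σ, ∑ u ∈ σ,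
        X.w (insert v σ) * (f ((insert v σ).erase u) * f σ) := by
  unfold WFam.inner
  rw [Finset.mul_sum]
  apply Finset.sum_congr rfl
  intro σ hσ
  rw [← mul_assoc, nonLazy_eq X hσ, mul_assoc, Finset.sum_mul]
  congr 1
  apply Finset.sum_congr rfl
  intro v _
  rw [Finset.sum_mul]
  apply Finset.sum_congr rfl
  intro u _
  ring

theorem up_norm (X : WSC V d) (c : ℕ) (hc : c ≤ d) (hc0 : 0 < c) (f : Finset V → ℝ) :
    ((c : ℝ) + 1) * X.toWFam.norm2 (c + 1) (sDiff c f) =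
      X.toWFam.norm2 c f + c * X.toWFam.inner c (X.toWFam.nonLazy c f) f := by
  have hc1 : (c : ℝ) ≠ 0 := by positivity
  have hc2 : (c : ℝ) + 1 ≠ 0 := by positivity
  have h1 : ∑ ρ ∈ X.toWFam.dimFaces (c + 1), ∑ v ∈ ρ, X.w ρ * (f (ρ.erase v) * f (ρ.erase v))
      = ((c : ℝ) + 1) * X.toWFam.norm2 c f := by
    rw [swap]
    unfold WFam.norm2 WFam.inner
    rw [Finset.mul_sum]
    apply Finset.sum_congr rfl
    intro σ hσ
    rw [← mul_assoc, ← wrec X hσ hc, Finset.sum_mul]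
    apply Finset.sum_congr rfl
    intro v hv
    rw [Finset.erase_insert (mem_nb.1 hv).1]
  have h2 : ∑ ρ ∈ X.toWFam.dimFaces (c + 1), ∑ v ∈ ρ, ∑ u ∈ ρ.erase v,
      X.w ρ * (f (ρ.erase u) * f (ρ.erase v))
      = (c : ℝ) * ((c : ℝ) + 1) * X.toWFam.inner c (X.toWFam.nonLazy c f) f := by
    rw [swap X c (fun ρ v => ∑ u ∈ ρ.erase v, X.w ρ * (f (ρ.erase u) * f (ρ.erase v))), Q_eq]
    have : (c : ℝ) * ((c : ℝ) + 1) * ((c : ℝ)⁻¹ * ((c : ℝ) + 1)⁻¹ *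
      ∑ σ ∈ X.toWFam.dimFaces c, ∑ v ∈ X.nb σ, ∑ u ∈ σ,
        X.w (insert v σ) * (f ((insert v σ).erase u) * f σ)) = ∑ σ ∈ X.toWFam.dimFaces c, ∑ v ∈ X.nb σ, ∑ u ∈ σ,
        X.w (insert v σ) * (f ((insert v σ).erase u) * f σ) := by field_simp
    rw [this]
    apply Finset.sum_congr rfl
    intro σ hσ
    apply Finset.sum_congr rfl
    intro v hv
    rw [Finset.erase_insert (mem_nb.1 hv).1]
  have h3 : ((c : ℝ) + 1) ^ 2 * X.toWFam.norm2 (c + 1) (sDiff c f) =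
    ∑ ρ ∈ X.toWFam.dimFaces (c + 1), ∑ v ∈ ρ, X.w ρ * (f (ρ.erase v) * f (ρ.erase v)) +
    ∑ ρ ∈ X.toWFam.dimFaces (c + 1), ∑ v ∈ ρ, ∑ u ∈ ρ.erase v,
      X.w ρ * (f (ρ.erase u) * f (ρ.erase v)) := by
    rw [← Finset.sum_add_distrib]
    unfold WFam.norm2 WFam.inner
    rw [Finset.mul_sum]
    apply Finset.sum_congr rfl
    intro ρ hρ
    rw [sDiff_eq c f ρ (mem_dF.1 hρ).2, ← Finset.sum_add_distrib]
    have : ((c : ℝ) + 1) ^ 2 * (X.w ρ * ((((c : ℝ) + 1)⁻¹ * ∑ v ∈ ρ, f (ρ.erase v)) *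
      (((c : ℝ) + 1)⁻¹ * ∑ v ∈ ρ, f (ρ.erase v)))) =
      X.w ρ * ((∑ v ∈ ρ, f (ρ.erase v)) * ∑ v ∈ ρ, f (ρ.erase v)) := by field_simp
    rw [this, Finset.sum_mul, Finset.mul_sum]
    apply Finset.sum_congr rfl
    intro v hv
    rw [← Finset.add_sum_erase ρ (fun u => f (ρ.erase u)) hv, mul_add, mul_add, Finset.mul_sum, Finset.mul_sum]
    congr 1
    apply Finset.sum_congr rfl
    intros; ring
  rw [h1, h2] at h3
  apply mul_left_cancel₀ hc2
  linear_combination h3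



theorem link_mem_one (X : WSC V d) (τ t : Finset V) :
    t ∈ (X.toWFam.link τ).dimFaces 1 ↔ ∃ v ∈ X.nb τ, t = {v} := by
  simp only [WFam.dimFaces, WFam.link, Finset.mem_filter, Finset.powerset_univ, Finset.mem_univ,
    true_and, Finset.card_eq_one, mem_nb]
  constructor
  · rintro ⟨⟨h1, h2⟩, v, rfl⟩
    exact ⟨v, ⟨by simpa using h1, by simpa [Finset.singleton_union] using h2⟩, rfl⟩
  · rintro ⟨v, ⟨h1, h2⟩, rfl⟩
    exact ⟨⟨by simpa using h1, by simpa [Finset.singleton_union] using h2⟩, v, rfl⟩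

theorem link_sum_one (X : WSC V d) (τ : Finset V) (F : Finset V → ℝ) :
    ∑ t ∈ (X.toWFam.link τ).dimFaces 1, F t = ∑ v ∈ X.nb τ, F {v} := by
  symm
  apply Finset.sum_nbij (fun v => {v})
  · intro v hv
    exact (link_mem_one X τ _).2 ⟨v, hv, rfl⟩
  · intro v _ u _ h
    simpa using h
  · intro t ht
    obtain ⟨v, hv, rfl⟩ := (link_mem_one X τ t).1 ht
    exact ⟨v, hv, rfl⟩
  · intros; rfl

theorem link_inner (X : WSC V d) {a : ℕ} {τ : Finset V} (h : τ ∈ X.toWFam.dimFaces a)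
    (g k : Finset V → ℝ) :
    (X.toWFam.link τ).inner 1 g k = (((a : ℝ) + 1) * X.w τ)⁻¹ *
      ∑ v ∈ X.nb τ, X.w (insert v τ) * (g {v} * k {v}) := by
  unfold WFam.inner
  rw [link_sum_one, Finset.mul_sum]
  apply Finset.sum_congr rfl
  intro v _
  rw [link_w_single X h]
  ring

theorem link_link_w (X : WSC V d) {a : ℕ} {τ : Finset V} (h : τ ∈ X.toWFam.dimFaces a)
    {u v : V} (hu : u ∈ X.nb τ) (hv : v ∈ X.nb (insert u τ)) :
    ((X.toWFam.link τ).link {u}).w ({v} \ {u}) =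
      X.w (insert v (insert u τ)) / (((a : ℝ) + 2) * X.w (insert u τ)) := by
  have hm := mem_dF.1 h
  have hw := (wpos h).ne'
  have hw1 := (wpos (ins_mem h hu)).ne'
  have hv' := mem_nb.1 hv
  have hne : v ≠ u := by
    rintro rfl
    exact hv'.1 (by simp)
  have e1 : ({v} : Finset V) \ {u} = {v} := by
    ext x; simp; rintro rfl; exact hne
  have e2 : ((X.toWFam.link τ).link {u}).w {v} =
    (X.toWFam.link τ).w ({v} ∪ {u}) / (((({v} : Finset V).card + ({u} : Finset V).card).choose
      ({u} : Finset V).card : ℝ) * (X.toWFam.link τ).w {u}) := rfl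
  have e3 : (X.toWFam.link τ).w ({v} ∪ {u}) = X.w (insert v (insert u τ)) /
      (((a + 2).choose 2 : ℝ) * X.w τ) := by
    simp only [WFam.link]
    have : ({v} ∪ {u} : Finset V).card = 2 := by
      rw [Finset.singleton_union, Finset.card_pair hne]
    rw [this, hm.2]
    have e4 : ({v} ∪ {u} ∪ τ : Finset V) = insert v (insert u τ) := by
      ext x; simp [or_assoc]
    rw [e4, Nat.add_comm 2 a, Nat.choose_symm_add]
  have e5 : ((a + 2).choose 2 : ℝ) = ((a : ℝ) + 2) * (a + 1) / 2 := by
    rw [Nat.cast_choose_two]; push_cast; ring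
  rw [e1, e2, e3, link_w_single X h, e5]
  simp only [Finset.card_singleton, Nat.choose_one_right]
  have : (a:ℝ) + 1 ≠ 0 := by positivity
  have : (a:ℝ) + 2 ≠ 0 := by positivity
  push_cast
  field_simp

theorem link_nonLazy (X : WSC V d) {a : ℕ} {τ : Finset V} (h : τ ∈ X.toWFam.dimFaces a)
    {u : V} (hu : u ∈ X.nb τ) (g : Finset V → ℝ) :
    (X.toWFam.link τ).nonLazy 1 g {u} = ∑ v ∈ X.nb (insert u τ),
      X.w (insert v (insert u τ)) / (((a : ℝ) + 2) * X.w (insert u τ)) * g {v} := by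
  unfold WFam.nonLazy
  have hu' := mem_nb.1 hu
  simp only [Nat.cast_one, inv_one, one_mul]
  symm
  apply Finset.sum_nbij (fun v => {v})
  · intro v hv
    have hv' := mem_nb.1 hv
    have hne : v ≠ u := by
      rintro rfl
      exact hv'.1 (by simp)
    rw [Finset.mem_filter, link_mem_one]
    refine ⟨⟨v, mem_nb.2 ⟨fun e => hv'.1 (by simp [e]), X.down_closed hv'.2 ?_⟩, rfl⟩, ?_⟩
    · intro x; simp only [Finset.mem_insert]; tauto
    · simp only [WFam.dimFaces, WFam.link, Finset.mem_filter, Finset.powerset_univ, Finset.mem_univ,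
        true_and]
      refine ⟨⟨?_, ?_⟩, ?_⟩
      · simp only [Finset.disjoint_union_left, Finset.disjoint_singleton_left]
        exact ⟨hu'.1, fun e => hv'.1 (by simp [e])⟩
      · convert hv'.2 using 1
        ext x; simp only [Finset.mem_union, Finset.mem_insert, Finset.mem_singleton]; tauto
      · rw [Finset.singleton_union, Finset.card_pair hne.symm]
  · intro v _ v' _ h
    simpa using h
  · intro t ht
    rw [Finset.mem_coe, Finset.mem_filter, link_mem_one] at ht
    obtain ⟨⟨v, hv, rfl⟩, h2⟩ := ht
    simp only [WFam.dimFaces, WFam.link, Finset.mem_filter, Finset.powerset_univ, Finset.mem_univ,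
        true_and] at h2
    refine ⟨v, ?_, rfl⟩
    rw [Finset.mem_coe, mem_nb]
    have hne : v ≠ u := by
      rintro rfl
      simp at h2
    refine ⟨?_, ?_⟩
    · rw [Finset.mem_insert, not_or]
      exact ⟨hne, (mem_nb.1 hv).1⟩
    · convert h2.1.2 using 1
      ext x; simp only [Finset.mem_union, Finset.mem_insert, Finset.mem_singleton]; tauto
  · intro v hv
    rw [link_link_w X h hu hv]

/-- bilinear forms -/
def BB (X : WSC V d) (τ : Finset V) (g k : V → ℝ) : ℝ :=
  ∑ u ∈ X.nb τ, ∑ v ∈ X.nb (insert u τ), X.w (insert v (insert u τ)) * (g v * k u)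

def AA (X : WSC V d) (τ : Finset V) (g k : V → ℝ) : ℝ :=
  ∑ u ∈ X.nb τ, X.w (insert u τ) * (g u * k u)

theorem BB_symm (X : WSC V d) (τ : Finset V) (g k : V → ℝ) : X.BB τ g k = X.BB τ k g := by
  unfold BB
  rw [Finset.sum_comm' (s' := fun v => X.nb (insert v τ)) (t' := X.nb τ)]
  · apply Finset.sum_congr rfl
    intro v _
    apply Finset.sum_congr rfl
    intro u _
    rw [Finset.insert_comm, mul_comm (g v)]
  · intro u v
    simp only [mem_nb, Finset.mem_insert, not_or]
    constructor
    · rintro ⟨⟨h1, h2⟩, ⟨h3, h4⟩, h5⟩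
      refine ⟨⟨⟨fun e => h3 e.symm, h1⟩, by rwa [Finset.insert_comm]⟩, h4, X.down_closed h5 ?_⟩
      intro x; simp only [Finset.mem_insert]; tauto
    · rintro ⟨⟨⟨h3, h1⟩, h5⟩, h4, h2⟩
      refine ⟨⟨h1, X.down_closed h5 ?_⟩, ⟨fun e => h3 e.symm, h4⟩, by rwa [Finset.insert_comm]⟩
      intro x; simp only [Finset.mem_insert]; tauto

theorem BB_one (X : WSC V d) {a : ℕ} {τ : Finset V} (h : τ ∈ X.toWFam.dimFaces a) (ha : a < d)
    (k : V → ℝ) : X.BB τ (fun _ => 1) k = ((a : ℝ) + 2) * X.AA τ (fun _ => 1) k := by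
  unfold BB AA
  rw [Finset.mul_sum]
  apply Finset.sum_congr rfl
  intro u hu
  have := wrec X (ins_mem h hu) ha
  rw [← Finset.sum_mul, this]
  push_cast
  ring

theorem AA_one (X : WSC V d) {a : ℕ} {τ : Finset V} (h : τ ∈ X.toWFam.dimFaces a) (ha : a < d) :
    X.AA τ (fun _ => 1) (fun _ => 1) = ((a : ℝ) + 1) * X.w τ := by
  unfold AA
  simp only [mul_one]
  exact wrec X h ha.le

theorem exp_BA (X : WSC V d) {a : ℕ} {τ : Finset V} (h : τ ∈ X.toWFam.dimFaces a) {γ : ℝ}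
    (he : (X.toWFam.link τ).isExpander γ) (g : V → ℝ) (hg : X.AA τ g (fun _ => 1) = 0) :
    X.BB τ g g ≤ ((a : ℝ) + 2) * (γ * X.AA τ g g) := by
  set G : Finset V → ℝ := fun s => ∑ v ∈ s, g v with hG
  have hGs : ∀ v, G {v} = g v := by intro v; simp [hG]
  have hw := wpos h
  have ha1 : (0:ℝ) < (a:ℝ) + 1 := by positivity
  have ha2 : (0:ℝ) < (a:ℝ) + 2 := by positivity
  have h1 := he G (by
    rw [link_inner X h]
    simp only [hGs]
    have : ∑ v ∈ X.nb τ, X.w (insert v τ) * (g v * 1) = 0 := hg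
    rw [this, mul_zero])
  unfold WFam.norm2 at h1
  rw [link_inner X h, link_inner X h] at h1
  have h2 : ∑ v ∈ X.nb τ, X.w (insert v τ) * ((X.toWFam.link τ).nonLazy 1 G {v} * G {v})
      = ((a : ℝ) + 2)⁻¹ * X.BB τ g g := by
    unfold BB
    rw [Finset.mul_sum]
    apply Finset.sum_congr rfl
    intro u hu
    have hwu := (wpos (ins_mem h hu)).ne'
    rw [link_nonLazy X h hu, Finset.sum_mul, Finset.mul_sum, Finset.mul_sum]
    apply Finset.sum_congr rfl
    intro v hv
    simp only [hGs]
    field_simp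
  have h3 : ∑ v ∈ X.nb τ, X.w (insert v τ) * (G {v} * G {v}) = X.AA τ g g := by
    simp only [hGs]; rfl
  rw [h2, h3] at h1
  have hp : 0 < (((a : ℝ) + 1) * X.w τ)⁻¹ := by positivity
  have h4 : ((a : ℝ) + 2)⁻¹ * X.BB τ g g ≤ γ * X.AA τ g g := by
    apply le_of_mul_le_mul_left _ hp
    linarith
  rwa [inv_mul_le_iff₀ ha2] at h4

/-- The averaging (down) operator. -/
def dn (X : WSC V d) (c : ℕ) (f : Finset V → ℝ) : Finset V → ℝ :=
  fun τ => (((c : ℝ) + 1) * X.w τ)⁻¹ * ∑ v ∈ X.nb τ, X.w (insert v τ) * f (insert v τ)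

theorem exp_mean (X : WSC V d) {a : ℕ} (ha : a < d) {τ : Finset V}
    (h : τ ∈ X.toWFam.dimFaces a) {γ : ℝ}
    (he : (X.toWFam.link τ).isExpander γ) (f : Finset V → ℝ) :
    X.BB τ (fun v => f (insert v τ)) (fun v => f (insert v τ)) ≤
      ((a : ℝ) + 2) * (γ * X.AA τ (fun v => f (insert v τ)) (fun v => f (insert v τ)) +
        (1 - γ) * (((a : ℝ) + 1) * (X.w τ * (X.dn a f τ * X.dn a f τ)))) := by
  set g : V → ℝ := fun v => f (insert v τ) with hg
  set m := X.dn a f τ with hm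
  have hw := wpos h
  have ha1 : (0:ℝ) < (a:ℝ) + 1 := by positivity
  have hA1 : X.AA τ (fun _ => 1) g = ((a : ℝ) + 1) * X.w τ * m := by
    rw [hm]; unfold dn AA
    field_simp
    simp [hg]
  have hAs : X.AA τ g (fun _ => 1) = X.AA τ (fun _ => 1) g := by
    unfold AA; simp
  have hA := AA_one X h ha
  have e1 : X.AA τ (fun v => g v - m) (fun _ => 1) = 0 := by
    have : X.AA τ (fun v => g v - m) (fun _ => 1) =
        X.AA τ g (fun _ => 1) - m * X.AA τ (fun _ => 1) (fun _ => 1) := by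
      unfold AA
      rw [Finset.mul_sum, ← Finset.sum_sub_distrib]
      apply Finset.sum_congr rfl
      intros; ring
    rw [this, hAs, hA1, hA]; ring
  have e2 : X.AA τ (fun v => g v - m) (fun v => g v - m) = X.AA τ g g - 2 * m * X.AA τ (fun _ => 1) g
      + m * m * X.AA τ (fun _ => 1) (fun _ => 1) := by
    unfold AA
    rw [Finset.mul_sum, Finset.mul_sum, ← Finset.sum_sub_distrib, ← Finset.sum_add_distrib]
    apply Finset.sum_congr rfl
    intros; ring
  have e3 : X.BB τ (fun v => g v - m) (fun v => g v - m) = X.BB τ g g - m * X.BB τ (fun _ => 1) g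
      - m * X.BB τ g (fun _ => 1)
      + m * m * X.BB τ (fun _ => 1) (fun _ => 1) := by
    unfold BB
    simp only [Finset.mul_sum, ← Finset.sum_sub_distrib, ← Finset.sum_add_distrib]
    apply Finset.sum_congr rfl
    intros
    apply Finset.sum_congr rfl
    intros; ring
  have h1 := exp_BA X h he _ e1
  rw [e2, e3, BB_symm X τ g (fun _ => 1), BB_one X h ha, BB_one X h ha, hA1, hA] at h1
  linarith

theorem norm_local (X : WSC V d) (a : ℕ) (f : Finset V → ℝ) :
    ∑ τ ∈ X.toWFam.dimFaces a, X.AA τ (fun v => f (insert v τ)) (fun v => f (insert v τ))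
      = ((a : ℝ) + 1) * X.toWFam.norm2 (a + 1) f := by
  unfold AA WFam.norm2 WFam.inner
  rw [← swap X a (fun ρ v => X.w ρ * (f ρ * f ρ)), Finset.mul_sum]
  apply Finset.sum_congr rfl
  intro ρ hρ
  rw [Finset.sum_const, nsmul_eq_mul, (mem_dF.1 hρ).2]
  push_cast; ring

theorem Q_local (X : WSC V d) (a : ℕ) (f : Finset V → ℝ) :
    ∑ τ ∈ X.toWFam.dimFaces a, X.BB τ (fun v => f (insert v τ)) (fun v => f (insert v τ))
      = ((a : ℝ) + 1) * ((a : ℝ) + 2) *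
        X.toWFam.inner (a + 1) (X.toWFam.nonLazy (a + 1) f) f := by
  rw [Q_eq]
  have e : ((a : ℝ) + 1) * ((a : ℝ) + 2) * ((((a + 1 : ℕ) : ℝ))⁻¹ * (((a + 1 : ℕ) : ℝ) + 1)⁻¹ *
      ∑ σ ∈ X.toWFam.dimFaces (a + 1), ∑ v ∈ X.nb σ, ∑ u ∈ σ,
        X.w (insert v σ) * (f ((insert v σ).erase u) * f σ)) =
      ∑ σ ∈ X.toWFam.dimFaces (a + 1), ∑ u ∈ σ, ∑ v ∈ X.nb σ,
        X.w (insert v σ) * (f (insert v (σ.erase u)) * f σ) := by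
    have h1 : (a:ℝ) + 1 ≠ 0 := by positivity
    have h2 : (a:ℝ) + 2 ≠ 0 := by positivity
    push_cast
    have h3 : (a:ℝ) + 1 + 1 = a + 2 := by ring
    rw [h3]
    field_simp
    apply Finset.sum_congr rfl
    intro σ hσ
    rw [Finset.sum_comm]
    apply Finset.sum_congr rfl
    intro u hu
    apply Finset.sum_congr rfl
    intro v hv
    rw [Finset.erase_insert_of_ne]
    rintro rfl
    exact (mem_nb.1 hv).1 hu
  rw [e, swap X a (fun σ u => ∑ v ∈ X.nb σ, X.w (insert v σ) * (f (insert v (σ.erase u)) * f σ))]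
  unfold BB
  apply Finset.sum_congr rfl
  intro τ hτ
  apply Finset.sum_congr rfl
  intro u hu
  rw [Finset.erase_insert (mem_nb.1 hu).1]

theorem local_to_global (X : WSC V d) {a : ℕ} (ha : a < d) {γ : ℝ}
    (he : ∀ τ ∈ X.toWFam.dimFaces a, (X.toWFam.link τ).isExpander γ) (f : Finset V → ℝ) :
    X.toWFam.inner (a + 1) (X.toWFam.nonLazy (a + 1) f) f ≤
      γ * X.toWFam.norm2 (a + 1) f + (1 - γ) * X.toWFam.norm2 a (X.dn a f) := by
  have h1 := Finset.sum_le_sum (fun τ hτ => exp_mean X ha hτ (he τ hτ) f)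
  rw [Q_local, ← Finset.mul_sum, Finset.sum_add_distrib, ← Finset.mul_sum, norm_local,
    ← Finset.mul_sum, ← Finset.mul_sum] at h1
  have h2 : ∑ τ ∈ X.toWFam.dimFaces a, X.w τ * (X.dn a f τ * X.dn a f τ)
    = X.toWFam.norm2 a (X.dn a f) := rfl
  rw [h2] at h1
  have hp : 0 < ((a : ℝ) + 1) * ((a : ℝ) + 2) := by positivity
  apply le_of_mul_le_mul_left _ hp
  linarith

theorem low_bound (X : WSC V d) {a : ℕ} (ha : a < d) {γ : ℝ}
    (he : ∀ τ ∈ X.toWFam.dimFaces a, (X.toWFam.link τ).isExpander γ) :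
    -1 ≤ ((d : ℝ) - a) * γ := by
  obtain ⟨ρ, hρ, -, hρc⟩ := X.isPure ∅ X.empty_mem
  obtain ⟨ρ', hρ', hρc'⟩ := Finset.exists_subset_card_eq (s := ρ) (n := a + 2) (by omega)
  obtain ⟨v, hv⟩ : ρ'.Nonempty := by rw [← Finset.card_pos]; omega
  obtain ⟨u, hu⟩ : (ρ'.erase v).Nonempty := by
    rw [← Finset.card_pos, Finset.card_erase_of_mem hv]; omega
  have hf : ρ' ∈ X.toWFam.dimFaces (a + 1 + 1) := mem_dF.2 ⟨X.down_closed hρ hρ', hρc'⟩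
  set τ := (ρ'.erase v).erase u with hτ
  have hτf : τ ∈ X.toWFam.dimFaces a := erase_mem (erase_mem hf hv) hu
  have huv : u ≠ v := (Finset.mem_erase.1 hu).1
  have hvu : v ≠ u := huv.symm
  have e1 : insert u τ = ρ'.erase v := Finset.insert_erase hu
  have e2 : insert v (insert u τ) = ρ' := by rw [e1, Finset.insert_erase hv]
  have e2' : insert u (insert v τ) = ρ' := by rw [Finset.insert_comm, e2]
  have huτ : u ∉ τ := by simp [hτ]
  have hvτ : v ∉ τ := by simp [hτ]
  have hun : u ∈ X.nb τ := mem_nb.2 ⟨huτ, X.down_closed (mem_dF.1 hf).1 (by rw [← e2]; simp)⟩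
  have hvn : v ∈ X.nb τ := mem_nb.2 ⟨hvτ, X.down_closed (mem_dF.1 hf).1 (by rw [← e2']; simp)⟩
  have hvn2 : v ∈ X.nb (insert u τ) :=
    mem_nb.2 ⟨by simp [hvτ, hvu], e2 ▸ (mem_dF.1 hf).1⟩
  have hun2 : u ∈ X.nb (insert v τ) :=
    mem_nb.2 ⟨by simp [huτ, huv], e2' ▸ (mem_dF.1 hf).1⟩
  have huu : u ∉ X.nb (insert u τ) := by simp [mem_nb]
  have hvv : v ∉ X.nb (insert v τ) := by simp [mem_nb]
  have hwu := wpos (ins_mem hτf hun)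
  have hwv := wpos (ins_mem hτf hvn)
  have hs1 := w_step X (ins_mem hτf hun) ha hvn2
  have hs2 := w_step X (ins_mem hτf hvn) ha hun2
  rw [e2] at hs1
  rw [e2'] at hs2
  set A := X.w (insert u τ) with hA
  set B := X.w (insert v τ) with hB
  set g : V → ℝ := fun x => (if x = u then A⁻¹ else 0) + (if x = v then -B⁻¹ else 0) with hg
  have hAA1 : X.AA τ g (fun _ => 1) = 0 := by
    unfold AA
    simp only [hg, mul_one, mul_add, Finset.sum_add_distrib, mul_ite, mul_zero,
      Finset.sum_ite_eq', hun, hvn, if_true]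
    rw [← hA, ← hB]
    field_simp
    ring
  have gu : g u = A⁻¹ := by simp [hg, huv]
  have gv : g v = -B⁻¹ := by simp [hg, hvu]
  have hAA : X.AA τ g g = A⁻¹ + B⁻¹ := by
    have : X.AA τ g g = ∑ x ∈ X.nb τ, ((if x = u then X.w (insert x τ) * (A⁻¹ * g x) else 0)
        + (if x = v then X.w (insert x τ) * (-B⁻¹ * g x) else 0)) := by
      unfold AA
      apply Finset.sum_congr rfl
      intro x _
      by_cases hx : x = u
      · subst hx
        simp [gu, huv]
      · by_cases hx' : x = v
        · subst hx'
          simp [gv, hvu]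
        · have : g x = 0 := by simp [hg, hx, hx']
          simp [this, hx, hx']
    rw [this, Finset.sum_add_distrib, Finset.sum_ite_eq', Finset.sum_ite_eq', if_pos hun, if_pos hvn,
      gu, gv, ← hA, ← hB]
    field_simp
  have inner_sum : ∀ x (c : ℝ), ∑ y ∈ X.nb (insert x τ), X.w (insert y (insert x τ)) * (g y * c) =
     (if u ∈ X.nb (insert x τ) then X.w (insert u (insert x τ)) * (A⁻¹ * c) else 0) +
     (if v ∈ X.nb (insert x τ) then X.w (insert v (insert x τ)) * (-B⁻¹ * c) else 0) := by
    intro x c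
    simp only [hg, add_mul, mul_add, Finset.sum_add_distrib, ite_mul, zero_mul, mul_ite, mul_zero,
      Finset.sum_ite_eq']
  have hBB : X.BB τ g g = -2 * X.w ρ' * (A⁻¹ * B⁻¹) := by
    have : X.BB τ g g = ∑ x ∈ X.nb τ, ((if x = u then ∑ y ∈ X.nb (insert x τ), X.w (insert y (insert x τ)) * (g y * A⁻¹) else 0)
        + (if x = v then ∑ y ∈ X.nb (insert x τ), X.w (insert y (insert x τ)) * (g y * -B⁻¹) else 0)) := by
      unfold BB
      apply Finset.sum_congr rfl
      intro x _
      by_cases hx : x = u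
      · subst hx
        simp [gu, huv]
      · by_cases hx' : x = v
        · subst hx'
          simp [gv, hvu]
        · have : g x = 0 := by simp [hg, hx, hx']
          simp [this, hx, hx']
    rw [this, Finset.sum_add_distrib, Finset.sum_ite_eq', Finset.sum_ite_eq', if_pos hun, if_pos hvn,
      inner_sum, inner_sum, if_neg huu, if_pos hvn2, if_pos hun2, if_neg hvv, e2, e2']
    ring
  have h1 := exp_BA X hτf (he τ hτf) g hAA1
  rw [hAA, hBB] at h1
  have hAB : 0 < A * B := mul_pos hwu hwv
  have h2 : -2 * X.w ρ' ≤ ((a : ℝ) + 2) * (γ * (A + B)) := by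
    have := mul_le_mul_of_nonneg_left h1 hAB.le
    have q1 : A * B * (-2 * X.w ρ' * (A⁻¹ * B⁻¹)) = -2 * X.w ρ' := by field_simp
    have q2 : A * B * (((a : ℝ) + 2) * (γ * (A⁻¹ + B⁻¹))) = ((a : ℝ) + 2) * (γ * (A + B)) := by
      field_simp
      ring
    rwa [q1, q2] at this
  push_cast at hs1 hs2
  have hda : (0:ℝ) < (d:ℝ) - a := by
    have : (a:ℝ) < d := by exact_mod_cast ha
    linarith
  have h3 := mul_le_mul_of_nonneg_left h2 hda.le
  have hP : 0 < ((a:ℝ) + 2) * (A + B) := by positivity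
  have h4 : (((a:ℝ) + 2) * (A + B)) * (-1) ≤ (((a:ℝ) + 2) * (A + B)) * (((d : ℝ) - a) * γ) := by
    linarith
  exact le_of_mul_le_mul_left h4 hP


/-- localized sums -/
def locS (X : WSC V d) (c : ℕ) (f : Finset V → ℝ) (σ : Finset V) : ℝ :=
  ∑ ρ ∈ (X.toWFam.dimFaces c).filter (fun ρ => σ ⊆ ρ), X.w ρ * f ρ

def lv (X : WSC V d) (i c : ℕ) (f : Finset V → ℝ) : Prop :=
  ∀ σ ∈ X.toWFam.dimFaces i, X.locS c f σ = 0

theorem link_inner_locS (X : WSC V d) {i c : ℕ} (hic : i ≤ c) {σ : Finset V}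
    (h : σ ∈ X.toWFam.dimFaces i) (f : Finset V → ℝ) :
    (X.toWFam.link σ).inner (c - i) (fun s => f (σ ∪ s)) (fun _ => 1) =
      ((c.choose i : ℝ) * X.w σ)⁻¹ * X.locS c f σ := by
  have hm := mem_dF.1 h
  unfold WFam.inner locS
  rw [Finset.mul_sum]
  refine Finset.sum_bij' (fun s _ => s ∪ σ) (fun ρ _ => ρ \ σ) ?_ ?_ ?_ ?_ ?_
  · intro s hs
    simp only [WFam.dimFaces, WFam.link, Finset.mem_filter, Finset.powerset_univ, Finset.mem_univ,
        true_and] at hs ⊢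
    refine ⟨⟨hs.1.2, ?_⟩, Finset.subset_union_right⟩
    rw [Finset.card_union_of_disjoint hs.1.1, hs.2, hm.2]; omega
  · intro ρ hρ
    simp only [WFam.dimFaces, WFam.link, Finset.mem_filter, Finset.powerset_univ, Finset.mem_univ,
        true_and] at hρ ⊢
    refine ⟨⟨Finset.sdiff_disjoint, ?_⟩, ?_⟩
    · rw [Finset.sdiff_union_of_subset hρ.2]; exact hρ.1.1
    · rw [Finset.card_sdiff_of_subset hρ.2, hρ.1.2, hm.2]
  · intro s hs
    simp only [WFam.dimFaces, WFam.link, Finset.mem_filter, Finset.powerset_univ, Finset.mem_univ,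
        true_and] at hs
    exact Finset.union_sdiff_cancel_right hs.1.1
  · intro ρ hρ
    exact Finset.sdiff_union_of_subset (Finset.mem_filter.1 hρ).2
  · intro s hs
    simp only [WFam.dimFaces, WFam.link, Finset.mem_filter, Finset.powerset_univ, Finset.mem_univ,
        true_and] at hs ⊢
    rw [hs.2, hm.2, Nat.sub_add_cancel hic, Finset.union_comm σ s]
    rw [mul_one, div_eq_inv_mul, mul_assoc]

theorem level_iff (X : WSC V d) {i c : ℕ} (hic : i ≤ c) (f : Finset V → ℝ) :
    X.toWFam.isLevel i c f ↔ X.lv i c f := by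
  unfold WFam.isLevel lv
  refine forall₂_congr fun σ hσ => ?_
  rw [link_inner_locS X hic hσ]
  have h1 : (c.choose i : ℝ) ≠ 0 := by exact_mod_cast (Nat.choose_pos hic).ne'
  have h2 := (wpos hσ).ne'
  simp [h1, h2]

theorem locS_congr (X : WSC V d) (c : ℕ) {f g : Finset V → ℝ}
    (h : ∀ ρ ∈ X.toWFam.dimFaces c, f ρ = g ρ) (σ : Finset V) : X.locS c f σ = X.locS c g σ := by
  unfold locS
  apply Finset.sum_congr rfl
  intro ρ hρ
  rw [h ρ (Finset.mem_filter.1 hρ).1]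

theorem lv_congr (X : WSC V d) (i c : ℕ) {f g : Finset V → ℝ}
    (h : ∀ ρ ∈ X.toWFam.dimFaces c, f ρ = g ρ) : X.lv i c f ↔ X.lv i c g := by
  unfold lv
  simp only [locS_congr X c h]

theorem locS_up (X : WSC V d) {i c : ℕ} (hic : i ≤ c) {σ : Finset V}
    (h : σ ∈ X.toWFam.dimFaces i) (f : Finset V → ℝ) :
    ∑ v ∈ X.nb σ, X.locS c f (insert v σ) = ((c : ℝ) - i) * X.locS c f σ := by
  have hm := mem_dF.1 h
  unfold locS
  rw [Finset.mul_sum]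
  rw [Finset.sum_comm' (s' := fun ρ => ρ \ σ)
    (t' := (X.toWFam.dimFaces c).filter (fun ρ => σ ⊆ ρ))]
  · apply Finset.sum_congr rfl
    intro ρ hρ
    simp only [Finset.mem_filter, mem_dF] at hρ
    rw [Finset.sum_const, nsmul_eq_mul, Finset.card_sdiff_of_subset hρ.2, hρ.1.2, hm.2,
      Nat.cast_sub hic]
  · intro v ρ
    simp only [Finset.mem_filter, mem_dF, mem_nb, Finset.mem_sdiff, Finset.insert_subset_iff]
    constructor
    · rintro ⟨⟨h1, h2⟩, h3, h4, h5⟩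
      exact ⟨⟨h4, h1⟩, h3, h5⟩
    · rintro ⟨⟨h4, h1⟩, h3, h5⟩
      exact ⟨⟨h1, X.down_closed h3.1 (Finset.insert_subset h4 h5)⟩, h3, h4, h5⟩

theorem lv_anti (X : WSC V d) {i c : ℕ} (hic : i + 1 ≤ c) {f : Finset V → ℝ}
    (hf : X.lv (i + 1) c f) : X.lv i c f := by
  intro σ hσ
  have h1 := locS_up X (by omega : i ≤ c) hσ f
  rw [Finset.sum_eq_zero (fun v hv => hf _ (ins_mem hσ hv))] at h1
  have h2 : (c : ℝ) - i ≠ 0 := by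
    have : (i : ℝ) + 1 ≤ c := by exact_mod_cast hic
    intro h; linarith
  rcases mul_eq_zero.1 h1.symm with h | h
  · exact absurd h h2
  · exact h

theorem lv_self (X : WSC V d) {c : ℕ} {f : Finset V → ℝ}
    (hf : X.lv c c f) : ∀ σ ∈ X.toWFam.dimFaces c, f σ = 0 := by
  intro σ hσ
  have h1 := hf σ hσ
  unfold locS at h1
  have : (X.toWFam.dimFaces c).filter (fun ρ => σ ⊆ ρ) = {σ} := by
    ext ρ
    simp only [Finset.mem_filter, Finset.mem_singleton]
    constructor
    · rintro ⟨h2, h3⟩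
      exact (Finset.eq_of_subset_of_card_le h3 (by rw [(mem_dF.1 h2).2, (mem_dF.1 hσ).2])).symm
    · rintro rfl
      exact ⟨hσ, le_rfl⟩
  rw [this, Finset.sum_singleton] at h1
  exact (mul_eq_zero.1 h1).resolve_left (wpos hσ).ne'

theorem locS_dn (X : WSC V d) {i c : ℕ} (hic : i ≤ c) {σ : Finset V}
    (h : σ ∈ X.toWFam.dimFaces i) (g : Finset V → ℝ) :
    X.locS c (X.dn c g) σ = ((c : ℝ) + 1)⁻¹ * (((c : ℝ) + 1 - i) * X.locS (c + 1) g σ) := by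
  have hm := mem_dF.1 h
  have hs := swap X c (fun ρ v => if σ ⊆ ρ.erase v then X.w ρ * g ρ else 0)
  have h1 : X.locS c (X.dn c g) σ = ((c : ℝ) + 1)⁻¹ * ∑ τ ∈ X.toWFam.dimFaces c, ∑ v ∈ X.nb τ,
      (if σ ⊆ (insert v τ).erase v then X.w (insert v τ) * g (insert v τ) else 0) := by
    unfold locS
    rw [Finset.sum_filter, Finset.mul_sum]
    apply Finset.sum_congr rfl
    intro τ hτ
    have hw := (wpos hτ).ne'
    have hc : (c : ℝ) + 1 ≠ 0 := by positivity
    have e : ∑ v ∈ X.nb τ,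
      (if σ ⊆ (insert v τ).erase v then X.w (insert v τ) * g (insert v τ) else 0) =
      ∑ v ∈ X.nb τ, (if σ ⊆ τ then X.w (insert v τ) * g (insert v τ) else 0) := by
      apply Finset.sum_congr rfl
      intro v hv
      rw [Finset.erase_insert (mem_nb.1 hv).1]
    rw [e]
    split_ifs with hst
    · unfold dn
      field_simp
    · simp
  rw [h1, ← hs]
  congr 1
  unfold locS
  rw [Finset.sum_filter, Finset.mul_sum]
  apply Finset.sum_congr rfl
  intro ρ hρ
  have hρ' := mem_dF.1 hρ
  rw [← Finset.sum_filter, Finset.sum_const, nsmul_eq_mul]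
  split_ifs with hst
  · have : ρ.filter (fun v => σ ⊆ ρ.erase v) = ρ \ σ := by
      ext v
      simp only [Finset.mem_filter, Finset.mem_sdiff, Finset.subset_erase]
      tauto
    rw [this, Finset.card_sdiff_of_subset hst, hρ'.2, hm.2, Nat.cast_sub (by omega)]
    push_cast; ring
  · have : ρ.filter (fun v => σ ⊆ ρ.erase v) = ∅ := by
      ext v
      simp only [Finset.mem_filter, Finset.subset_erase]
      simp [hst]
    rw [this]; simp

theorem lv_dn (X : WSC V d) {i c : ℕ} (hic : i ≤ c) {g : Finset V → ℝ}
    (hg : X.lv i (c + 1) g) : X.lv i c (X.dn c g) := by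
  intro σ hσ
  rw [locS_dn X hic hσ, hg σ hσ]; simp

theorem adj (X : WSC V d) (c : ℕ) (f g : Finset V → ℝ) :
    X.toWFam.inner (c + 1) (sDiff c f) g = X.toWFam.inner c f (X.dn c g) := by
  have hs := swap X c (fun ρ v => ((c : ℝ) + 1)⁻¹ * (X.w ρ * (f (ρ.erase v) * g ρ)))
  unfold WFam.inner
  trans ∑ ρ ∈ X.toWFam.dimFaces (c + 1), ∑ v ∈ ρ, ((c : ℝ) + 1)⁻¹ * (X.w ρ * (f (ρ.erase v) * g ρ))
  · apply Finset.sum_congr rfl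
    intro ρ hρ
    rw [sDiff_eq c f ρ (mem_dF.1 hρ).2, Finset.mul_sum, Finset.sum_mul, Finset.mul_sum]
    apply Finset.sum_congr rfl
    intros; ring
  · rw [hs]
    apply Finset.sum_congr rfl
    intro σ hσ
    have hw := (wpos hσ).ne'
    have hc : (c : ℝ) + 1 ≠ 0 := by positivity
    unfold dn
    rw [Finset.mul_sum, Finset.mul_sum, Finset.mul_sum]
    apply Finset.sum_congr rfl
    intro v hv
    rw [Finset.erase_insert (mem_nb.1 hv).1]
    field_simp

/-- the Euclidean model of cochains -/
abbrev EE (X : WSC V d) (c : ℕ) : Type _ := EuclideanSpace ℝ ↥(X.toWFam.dimFaces c)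

def emb (X : WSC V d) (c : ℕ) (f : Finset V → ℝ) : X.EE c :=
  WithLp.toLp 2 (fun σ => √(X.w σ.1) * f σ.1)

def unemb (X : WSC V d) (c : ℕ) (x : X.EE c) : Finset V → ℝ :=
  fun σ => if h : σ ∈ X.toWFam.dimFaces c then x ⟨σ, h⟩ / √(X.w σ) else 0

theorem emb_unemb (X : WSC V d) (c : ℕ) (x : X.EE c) : X.emb c (X.unemb c x) = x := by
  ext ⟨σ, hσ⟩
  have : √(X.w σ) ≠ 0 := (Real.sqrt_pos.2 (wpos hσ)).ne'
  simp only [emb, unemb, hσ, dif_pos]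
  field_simp

theorem unemb_emb (X : WSC V d) (c : ℕ) (f : Finset V → ℝ) :
    ∀ σ ∈ X.toWFam.dimFaces c, X.unemb c (X.emb c f) σ = f σ := by
  intro σ hσ
  have : √(X.w σ) ≠ 0 := (Real.sqrt_pos.2 (wpos hσ)).ne'
  simp only [emb, unemb, hσ, dif_pos]
  field_simp

theorem inner_emb (X : WSC V d) (c : ℕ) (f g : Finset V → ℝ) :
    inner ℝ (X.emb c f) (X.emb c g) = X.toWFam.inner c f g := by
  unfold WFam.inner
  rw [← Finset.sum_coe_sort, PiLp.inner_apply]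
  apply Finset.sum_congr rfl
  rintro ⟨σ, hσ⟩ _
  simp only [emb, RCLike.inner_apply, conj_trivial]
  have := Real.mul_self_sqrt (wpos hσ).le
  linear_combination (f σ * g σ) * this

theorem norm_emb (X : WSC V d) (c : ℕ) (f : Finset V → ℝ) :
    ‖X.emb c f‖ ^ 2 = X.toWFam.norm2 c f := by
  rw [← real_inner_self_eq_norm_sq, inner_emb]; rfl

theorem emb_congr (X : WSC V d) (c : ℕ) {f g : Finset V → ℝ}
    (h : ∀ ρ ∈ X.toWFam.dimFaces c, f ρ = g ρ) : X.emb c f = X.emb c g := by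
  ext ⟨σ, hσ⟩
  simp only [emb, h σ hσ]

theorem emb_sum (X : WSC V d) (c : ℕ) (s : Finset ℕ) (f : ℕ → Finset V → ℝ) :
    ∑ i ∈ s, X.emb c (f i) = X.emb c (fun σ => ∑ i ∈ s, f i σ) := by
  ext ⟨σ, hσ⟩
  simp [emb, Finset.mul_sum]

theorem unemb_add (X : WSC V d) (c : ℕ) (x y : X.EE c) :
    X.unemb c (x + y) = X.unemb c x + X.unemb c y := by
  ext σ
  by_cases h : σ ∈ X.toWFam.dimFaces c
  · simp [unemb, h, add_div]
  · simp [unemb, h]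

theorem unemb_smul (X : WSC V d) (c : ℕ) (r : ℝ) (x : X.EE c) :
    X.unemb c (r • x) = r • X.unemb c x := by
  ext σ
  by_cases h : σ ∈ X.toWFam.dimFaces c
  · simp [unemb, h, mul_div_assoc]
  · simp [unemb, h]

theorem sDiff_add (c : ℕ) (f g : Finset V → ℝ) : sDiff c (f + g) = sDiff c f + sDiff c g := by
  ext σ
  simp [sDiff, Finset.sum_add_distrib, mul_add]

theorem sDiff_smul (c : ℕ) (r : ℝ) (f : Finset V → ℝ) : sDiff c (r • f) = r • sDiff c f := by
  ext σ
  simp only [sDiff, Pi.smul_apply, smul_eq_mul, ← Finset.mul_sum]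
  ring

def UU (X : WSC V d) (c : ℕ) : X.EE c →ₗ[ℝ] X.EE (c + 1) where
  toFun x := X.emb (c + 1) (sDiff c (X.unemb c x))
  map_add' x y := by
    rw [unemb_add, sDiff_add]
    ext σ
    simp [emb, mul_add]
  map_smul' r x := by
    rw [unemb_smul, sDiff_smul]
    ext σ
    simp only [emb, Pi.smul_apply, smul_eq_mul, PiLp.smul_apply, RingHom.id_apply]
    ring

theorem UU_apply (X : WSC V d) (c : ℕ) (x : X.EE c) :
    X.UU c x = X.emb (c + 1) (sDiff c (X.unemb c x)) := rfl

theorem UU_emb (X : WSC V d) (c : ℕ) (f : Finset V → ℝ) :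
    X.UU c (X.emb c f) = X.emb (c + 1) (sDiff c f) := by
  rw [UU_apply]
  apply emb_congr
  intro ρ hρ
  rw [sDiff_eq c _ ρ (mem_dF.1 hρ).2, sDiff_eq c _ ρ (mem_dF.1 hρ).2]
  congr 1
  apply Finset.sum_congr rfl
  intro v hv
  exact unemb_emb X c f _ (erase_mem hρ hv)

def DD (X : WSC V d) (c : ℕ) (y : X.EE (c + 1)) : X.EE c := X.emb c (X.dn c (X.unemb (c + 1) y))

def LL (X : WSC V d) (c i : ℕ) : Submodule ℝ (X.EE c) where
  carrier := {x | X.lv i c (X.unemb c x)}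
  add_mem' {x y} hx hy := by
    intro σ hσ
    have h1 := hx σ hσ
    have h2 := hy σ hσ
    rw [unemb_add]
    unfold locS at *
    simp only [Pi.add_apply, mul_add, Finset.sum_add_distrib, h1, h2, add_zero]
  zero_mem' := by
    intro σ hσ
    unfold locS
    apply Finset.sum_eq_zero
    intro ρ _
    simp [unemb]
  smul_mem' r x hx := by
    intro σ hσ
    have h1 := hx σ hσ
    rw [unemb_smul]
    unfold locS at *
    simp only [Pi.smul_apply, smul_eq_mul, mul_left_comm _ r, ← Finset.mul_sum, h1, mul_zero]

theorem mem_LL (X : WSC V d) (c i : ℕ) (x : X.EE c) : x ∈ X.LL c i ↔ X.lv i c (X.unemb c x) := Iff.rfl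

theorem emb_mem_LL (X : WSC V d) (c i : ℕ) (f : Finset V → ℝ) :
    X.emb c f ∈ X.LL c i ↔ X.lv i c f := by
  rw [mem_LL]
  exact lv_congr X i c (unemb_emb X c f)

end WSC

/-- Fine grained analysis of high dimensional random walks.
Let `γ` assign to every cardinality `a` (i.e. paper dimension `j = a - 1`,
`-1 ≤ j ≤ d - 2`) a bound `γ a ≤ 1` on the second largest eigenvalue of the
non-lazy random walk on the 1-skeleton of the link of every `σ ∈ X(a - 1)`
(Rayleigh form; `a = 0` is `X` itself). Let `0 ≤ k ≤ d - 1`, let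
`fᵢ ∈ C^k(X;ℝ)` be proper `i`-level cochains w.r.t. localization for
`0 ≤ i ≤ k`, and `f = Σᵢ fᵢ`. Then
`⟨M_k^+ f, f⟩ ≤ Σ_{i=0}^k (1 - (1/(k-i+1)) Π_{j=i-1}^{k-1} (1 - γ_j)) ‖fᵢ‖²`. -/
theorem fine_grained_random_walk (X : WSC V d) (k : ℕ) (hk : k + 1 ≤ d)
    (γ : ℕ → ℝ) (hγ : ∀ a ≤ d - 1, γ a ≤ 1)
    (hexp : ∀ a ≤ d - 1, ∀ σ ∈ X.toWFam.dimFaces a,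
      (X.toWFam.link σ).isExpander (γ a))
    (f : ℕ → Finset V → ℝ)
    (hf : ∀ i ≤ k, X.toWFam.isProperLevel i (k + 1) (f i)) :
    X.toWFam.inner (k + 1)
        (X.toWFam.nonLazy (k + 1) (fun σ => ∑ i ∈ Finset.range (k + 1), f i σ))
        (fun σ => ∑ i ∈ Finset.range (k + 1), f i σ)
      ≤ ∑ i ∈ Finset.range (k + 1),
          (1 - (((k - i : ℕ) : ℝ) + 1)⁻¹ * ∏ a ∈ Finset.Icc i k, (1 - γ a)) *
            X.toWFam.norm2 (k + 1) (f i) := by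
  have hexp' : ∀ a < d, ∀ σ ∈ X.toWFam.dimFaces a, (X.toWFam.link σ).isExpander (γ a) :=
    fun a ha => hexp a (by omega)
  have key : ∀ k < d, ∀ f : Finset V → ℝ,
      ((k : ℝ) + 2) / (k + 1) * (X.toWFam.norm2 (k + 1) f -
        X.toWFam.norm2 (k + 1 + 1) (sDiff (k + 1) f)) =
      X.toWFam.norm2 (k + 1) f - X.toWFam.inner (k + 1) (X.toWFam.nonLazy (k + 1) f) f := by
    intro k hk f
    have h1 := WSC.up_norm X (k + 1) hk (by omega) f
    push_cast at h1
    have h2 : (k : ℝ) + 1 ≠ 0 := by positivity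
    field_simp
    linear_combination -h1
  have main := abs_main (E := fun c => X.EE c) X.LL X.UU X.DD ?_ ?_ ?_ ?_ d γ
    (fun a ha => hγ a (by omega)) (fun a ha => WSC.low_bound X ha (hexp' a ha)) ?_ k (by omega)
    (fun i => X.emb (k + 1) (f i)) ?_ ?_
  · rw [WSC.emb_sum, WSC.UU_emb, WSC.norm_emb, WSC.norm_emb, key k (by omega)] at main
    simp only [WSC.norm_emb] at main
    linarith
  · intro c x y
    rw [WSC.UU_apply]
    conv_lhs => rw [← WSC.emb_unemb X (c + 1) y]
    conv_rhs => rw [← WSC.emb_unemb X c x]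
    rw [WSC.DD, WSC.inner_emb, WSC.inner_emb, WSC.adj]
  · intro c
    rw [eq_bot_iff]
    intro x hx
    have h1 := WSC.lv_self X ((WSC.mem_LL X c c x).1 hx)
    rw [Submodule.mem_bot, ← WSC.emb_unemb X c x, WSC.emb_congr X c (g := fun _ => 0) h1]
    ext σ
    simp [WSC.emb]
  · intro c i hic x hx
    exact WSC.lv_anti X hic hx
  · intro c i hic y hy
    exact (WSC.emb_mem_LL X c i _).2 (WSC.lv_dn X hic hy)
  · intro k hk x
    have h1 := WSC.local_to_global X hk (hexp' k hk) (X.unemb (k + 1) x)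
    rw [← WSC.emb_unemb X (k + 1) x, WSC.UU_emb, WSC.norm_emb, WSC.norm_emb, key k hk, WSC.emb_unemb,
      WSC.DD, WSC.norm_emb]
    linarith
  · intro i hi
    exact (WSC.emb_mem_LL X _ _ _).2 ((WSC.level_iff X (by omega) _).1 (hf i hi).1)
  · intro i hi y hy
    have h1 := (hf i hi).2 (X.unemb (k + 1) y) ((WSC.level_iff X (by omega) _).2 hy)
    rw [← WSC.emb_unemb X (k + 1) y, WSC.inner_emb]
    exact h1

end

end HDRW
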